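/- arXiv:2102.02419 — 3 statements merged into one kernel-verified Lean document; each statement's English description precedes it below -/
import Mathlib

section
/- Let n ≥ 3 and let (J₁,…,J_n, f₁,…,f_n) be a fast n-ring whose group G_n acts minimally on S¹. Then H_n = [G_n, G_n] is a simple group: its only normal subgroups are {id} and H_n itself. -/
open Set

noncomputable section

/-- The circle `S¹ = ℝ/ℤ`. -/
abbrev S1 : Type := AddCircle (1 : ℝ)

/-- A bijection of `S¹` is an orientation-preserving homeomorphism if it admits a lift
to an increasing map `h : ℝ → ℝ` with `h (x + 1) = h x + 1`. -/
def CircleOP (f : Equiv.Perm S1) : Prop :=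
  ∃ h : ℝ → ℝ, StrictMono h ∧ (∀ x : ℝ, h (x + 1) = h x + 1) ∧
    ∀ x : ℝ, ((h x : ℝ) : S1) = f (x : S1)

/-- `ringIter f i x l` is the point `x · f_i f_{i+1} ⋯ f_{i+l}` (right action:
apply `f_i` first). -/
def ringIter {n : ℕ} (f : ZMod n → Equiv.Perm S1) (i : ZMod n) (x : S1) : ℕ → S1
  | 0 => f i x
  | l + 1 => f (i + (l : ZMod n) + 1) (ringIter f i x l)

/-- A fast `n`-ring of intervals and homeomorphisms on `S¹` (Definition 1.3 of the
paper), together with the dynamical condition `(*)`. The arcs `J i` are proper open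
connected subsets covering `S¹`; consecutive arcs overlap in a proper nonempty
connected subarc and non-consecutive arcs are disjoint; `f i` is an
orientation-preserving homeomorphism with support exactly `J i`; `x i` is the endpoint
of `J (i+1)` lying in `J i`; and `(*)` holds. -/
structure FastRing (n : ℕ) where
  J : ZMod n → Set S1
  f : ZMod n → Equiv.Perm S1
  x : ZMod n → S1
  isOpen' : ∀ i, IsOpen (J i)
  isConn : ∀ i, IsConnected (J i)
  proper : ∀ i, J i ≠ Set.univ
  covers : (⋃ i, J i) = Set.univ
  disj : ∀ i j : ZMod n, i ≠ j → i - j ≠ 1 → j - i ≠ 1 → J i ∩ J j = ∅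
  adj_nonempty : ∀ i, (J i ∩ J (i + 1)).Nonempty
  adj_conn : ∀ i, IsConnected (J i ∩ J (i + 1))
  adj_ssub_left : ∀ i, J i ∩ J (i + 1) ⊂ J i
  adj_ssub_right : ∀ i, J i ∩ J (i + 1) ⊂ J (i + 1)
  orient : ∀ i, CircleOP (f i)
  supp : ∀ i, {p : S1 | f i p ≠ p} = J i
  x_mem : ∀ i, x i ∈ J i
  x_endpoint : ∀ i, x i ∈ frontier (J (i + 1))
  fast : ∀ i : ZMod n, ∀ l : ℕ, 1 ≤ l → l ≤ n →
    ringIter f i (x i) l ∈ J (i + (l : ZMod n) + 1)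

/-- The fast `n`-ring group `G_n = ⟨f₁, …, f_n⟩`. -/
def Gn {n : ℕ} (R : FastRing n) : Subgroup (Equiv.Perm S1) :=
  Subgroup.closure (Set.range R.f)

/-- The derived subgroup `H_n = [G_n, G_n]`. -/
def Hn {n : ℕ} (R : FastRing n) : Subgroup (Equiv.Perm S1) := ⁅Gn R, Gn R⁆

/-- Minimality of the action of a group `G` of bijections of `S¹`: every orbit is
dense. -/
def MinimalAct (G : Subgroup (Equiv.Perm S1)) : Prop :=
  ∀ p : S1, Dense {q : S1 | ∃ g ∈ G, g p = q}

section Arcs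

theorem coe_S1_eq_iff {x y : ℝ} : (x : S1) = (y : S1) ↔ ∃ z : ℤ, y = x + z := by
  rw [eq_comm, ← sub_eq_zero, ← AddCircle.coe_sub, AddCircle.coe_eq_zero_iff]
  constructor
  · rintro ⟨z, hz⟩
    exact ⟨z, by simp at hz; linarith⟩
  · rintro ⟨z, hz⟩
    exact ⟨z, by simp [hz]⟩

theorem eq_of_coe_S1_eq {x y : ℝ} (h : (x : S1) = (y : S1)) (h₁ : x - y < 1) (h₂ : y - x < 1) :
    x = y := by
  obtain ⟨z, hz⟩ := coe_S1_eq_iff.1 h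
  have h₃ : (z : ℝ) < 1 := by linarith
  have h₄ : (-1 : ℝ) < z := by linarith
  have h₅ : z = 0 := by
    have : z < 1 := by exact_mod_cast h₃
    have : -1 < z := by exact_mod_cast h₄
    omega
  simp [hz, h₅]

theorem continuous_coe_S1 : Continuous (fun x : ℝ => (x : S1)) := AddCircle.continuous_mk' 1

theorem coe_mem_image_Ioo_iff {p c d x : ℝ} (hc : p ≤ c) (hd : d ≤ p + 1)
    (hx : x ∈ Icc p (p + 1)) : (x : S1) ∈ (fun x : ℝ => (x : S1)) '' Ioo c d ↔ x ∈ Ioo c d := by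
  refine ⟨?_, fun h => ⟨x, h, rfl⟩⟩
  rintro ⟨y, hy, hyx⟩
  rw [← eq_of_coe_S1_eq hyx (by linarith [hy.1, hy.2, hx.1, hx.2])
    (by linarith [hy.1, hy.2, hx.1, hx.2])]
  exact hy

theorem coe_mem_image_Icc_iff {p c d x : ℝ} (hc : p < c) (hd : d < p + 1)
    (hx : x ∈ Icc p (p + 1)) : (x : S1) ∈ (fun x : ℝ => (x : S1)) '' Icc c d ↔ x ∈ Icc c d := by
  refine ⟨?_, fun h => ⟨x, h, rfl⟩⟩
  rintro ⟨y, hy, hyx⟩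
  rw [← eq_of_coe_S1_eq hyx (by linarith [hy.1, hy.2, hx.1, hx.2])
    (by linarith [hy.1, hy.2, hx.1, hx.2])]
  exact hy

theorem isPreconnected_preimage_Ioo {p : ℝ} {J : Set S1} (hJ : IsPreconnected J)
    (hp : (p : S1) ∉ J) :
    IsPreconnected {x : ℝ | x ∈ Ioo p (p + 1) ∧ (x : S1) ∈ J} := by
  let e := AddCircle.openPartialHomeomorphCoe (1 : ℝ) p
  have hsub : J ⊆ e.target := fun y hy h => hp (by rwa [← show y = (p : S1) from h])
  have himg : e.symm '' J = {x : ℝ | x ∈ Ioo p (p + 1) ∧ (x : S1) ∈ J} := by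
    ext x
    constructor
    · rintro ⟨y, hy, rfl⟩
      exact ⟨e.map_target (hsub hy), by
        have := e.right_inv (hsub hy)
        change e (e.symm y) ∈ J
        rwa [this]⟩
    · rintro ⟨hx, hxJ⟩
      exact ⟨(x : S1), hxJ, e.left_inv hx⟩
  rw [← himg]
  exact hJ.image _ (e.continuousOn_symm.mono hsub)

theorem exists_coe_mem_Ioo {p : ℝ} {y : S1} (hy : y ≠ (p : S1)) :
    ∃ x ∈ Ioo p (p + 1), (x : S1) = y := by
  let e := AddCircle.openPartialHomeomorphCoe (1 : ℝ) p
  exact ⟨e.symm y, e.map_target (show y ∈ e.target from hy), e.right_inv (show y ∈ e.target from hy)⟩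

/-- An open connected subset of the circle missing a point is the image of an open interval. -/
theorem exists_eq_image_Ioo {p : ℝ} {J : Set S1} (hJo : IsOpen J) (hJ : IsConnected J)
    (hp : (p : S1) ∉ J) :
    ∃ c d, p ≤ c ∧ c < d ∧ d ≤ p + 1 ∧ J = (fun x : ℝ => (x : S1)) '' Ioo c d := by
  set T := {x : ℝ | x ∈ Ioo p (p + 1) ∧ (x : S1) ∈ J} with hT
  have hTJ : (fun x : ℝ => (x : S1)) '' T = J := by
    ext y
    constructor
    · rintro ⟨x, hx, rfl⟩
      exact hx.2
    · intro hy
      obtain ⟨x, hx, rfl⟩ := exists_coe_mem_Ioo (p := p) (y := y) (fun h => hp (h ▸ hy))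
      exact ⟨x, ⟨hx, hy⟩, rfl⟩
  have hTo : IsOpen T := isOpen_Ioo.inter (hJo.preimage continuous_coe_S1)
  have hTne : T.Nonempty := by
    rw [← Set.image_nonempty, hTJ]
    exact hJ.nonempty
  have hTc : IsConnected T := ⟨hTne, isPreconnected_preimage_Ioo hJ.isPreconnected hp⟩
  have hbb : BddBelow T := ⟨p, fun x hx => hx.1.1.le⟩
  have hba : BddAbove T := ⟨p + 1, fun x hx => hx.1.2.le⟩
  have hTI : T = Ioo (sInf T) (sSup T) := by
    refine Subset.antisymm (fun x hx => ?_) (hTc.Ioo_csInf_csSup_subset hbb hba)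
    obtain ⟨ε, hε, hball⟩ := Metric.isOpen_iff.1 hTo x hx
    rw [Real.ball_eq_Ioo] at hball
    have h₁ := csInf_le hbb (hball (show x - ε / 2 ∈ Ioo (x - ε) (x + ε) by
      constructor <;> linarith))
    have h₂ := le_csSup hba (hball (show x + ε / 2 ∈ Ioo (x - ε) (x + ε) by
      constructor <;> linarith))
    constructor <;> linarith
  obtain ⟨x, hx⟩ := hTne
  have hx' := hTI ▸ hx
  exact ⟨sInf T, sSup T, le_csInf ⟨x, hx⟩ fun y hy => hy.1.1.le, hx'.1.trans hx'.2,
    csSup_le ⟨x, hx⟩ fun y hy => hy.1.2.le, by rw [← hTI, hTJ]⟩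

/-- Two proper open arcs that cover the circle have a disconnected intersection. -/
theorem union_ne_univ_of_isPreconnected_inter {A B : Set S1} (hAo : IsOpen A) (hBo : IsOpen B)
    (hB : IsConnected B) (hA' : A ≠ univ) (hB' : B ≠ univ)
    (hAB : IsPreconnected (A ∩ B)) : A ∪ B ≠ univ := by
  intro hcov
  obtain ⟨q, hq⟩ := (ne_univ_iff_exists_notMem A).1 hA'
  obtain ⟨r, hr⟩ := (ne_univ_iff_exists_notMem B).1 hB'
  obtain ⟨r, rfl⟩ := QuotientAddGroup.mk_surjective r
  change (r : S1) ∉ B at hr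
  have hmem : ∀ y, y ∉ A → y ∈ B := fun y hy =>
    (hcov ▸ mem_univ y : y ∈ A ∪ B).resolve_left hy
  obtain ⟨c, d, hrc, hcd, hdr, rfl⟩ := exists_eq_image_Ioo hBo hB hr
  let e := AddCircle.openPartialHomeomorphCoe (1 : ℝ) r
  have hsub : Aᶜ ⊆ e.target := fun y hy h => hr (by
    rw [← show y = (r : S1) from h]
    exact hmem y hy)
  have hK : IsCompact (e.symm '' Aᶜ) :=
    hAo.isClosed_compl.isCompact.image_of_continuousOn (e.continuousOn_symm.mono hsub)
  have hKmem : ∀ x ∈ e.symm '' Aᶜ, x ∈ Ioo c d ∧ (x : S1) ∉ A := by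
    rintro x ⟨y, hy, rfl⟩
    have h₁ : ((e.symm y : ℝ) : S1) = y := e.right_inv (hsub hy)
    have h₂ := e.map_target (hsub hy)
    refine ⟨?_, by rw [h₁]; exact hy⟩
    rw [← coe_mem_image_Ioo_iff hrc hdr ⟨h₂.1.le, h₂.2.le⟩, h₁]
    exact hmem y hy
  have hKA : ∀ x ∈ Ioo c d, (x : S1) ∉ A → x ∈ e.symm '' Aᶜ := fun x hx hxA =>
    ⟨(x : S1), hxA, e.left_inv (show x ∈ Ioo r (r + 1) from
      ⟨lt_of_le_of_lt hrc hx.1, lt_of_lt_of_le hx.2 hdr⟩)⟩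
  have hKne : (e.symm '' Aᶜ).Nonempty := ⟨_, q, hq, rfl⟩
  obtain ⟨m₁, hm₁, hmin⟩ := hK.exists_isLeast hKne
  obtain ⟨m₂, hm₂, hmax⟩ := hK.exists_isGreatest hKne
  obtain ⟨⟨hcm, hmd⟩, hm₁A⟩ := hKmem m₁ hm₁
  obtain ⟨⟨hcm₂, hmd₂⟩, -⟩ := hKmem m₂ hm₂
  obtain ⟨y₁, hy₁, hy₁'⟩ := exists_between hcm
  obtain ⟨y₂, hy₂, hy₂'⟩ := exists_between hmd₂
  have hpre := isPreconnected_preimage_Ioo hAB (p := r) (fun h => hr h.2)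
  have hy₁I : y₁ ∈ Ioo c d := ⟨hy₁, hy₁'.trans hmd⟩
  have hy₂I : y₂ ∈ Ioo c d := ⟨hcm₂.trans hy₂, hy₂'⟩
  have hIr : ∀ x ∈ Ioo c d, x ∈ Ioo r (r + 1) := fun x hx =>
    ⟨lt_of_le_of_lt hrc hx.1, lt_of_lt_of_le hx.2 hdr⟩
  have h₁ : y₁ ∈ {x : ℝ | x ∈ Ioo r (r + 1) ∧
      (x : S1) ∈ A ∩ (fun x : ℝ => (x : S1)) '' Ioo c d} := by
    refine ⟨hIr _ hy₁I, ?_, y₁, hy₁I, rfl⟩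
    by_contra h
    exact absurd (hmin (hKA _ hy₁I h)) (not_le.2 hy₁')
  have h₂ : y₂ ∈ {x : ℝ | x ∈ Ioo r (r + 1) ∧
      (x : S1) ∈ A ∩ (fun x : ℝ => (x : S1)) '' Ioo c d} := by
    refine ⟨hIr _ hy₂I, ?_, y₂, hy₂I, rfl⟩
    by_contra h
    exact absurd (hmax (hKA _ hy₂I h)) (not_le.2 hy₂)
  have h₃ := hpre.ordConnected.out h₁ h₂ ⟨hy₁'.le, (hmin hm₂).trans hy₂.le⟩
  exact hm₁A h₃.2.1

end Arcs

section Dynamics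

/-- The powers of `f` move every closed set missing `s`, intersected with `J`, into every
neighbourhood of `t`. -/
def Pushes (f : Equiv.Perm S1) (J : Set S1) (s t : S1) : Prop :=
  ∀ C : Set S1, IsClosed C → s ∉ C → ∀ W : Set S1, IsOpen W → t ∈ W →
    ∃ m : ℤ, ∀ y ∈ C ∩ J, (f ^ m) y ∈ W

theorem CircleOP.exists_orderIso {f : Equiv.Perm S1} (hf : CircleOP f) :
    ∃ h : ℝ ≃o ℝ, (∀ x, h (x + 1) = h x + 1) ∧ ∀ x : ℝ, ((h x : ℝ) : S1) = f (x : S1) := by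
  obtain ⟨h, hmono, hper, hlift⟩ := hf
  have hint : ∀ (z : ℤ) (x : ℝ), h (x + z) = h x + z := by
    intro z x
    induction z using Int.induction_on generalizing x with
    | zero => simp
    | succ k ih =>
      rw [show (x + ((k + 1 : ℤ) : ℝ)) = (x + (k : ℤ)) + 1 by push_cast; ring, hper, ih]
      push_cast; ring
    | pred k ih =>
      have := hper (x + ((-k - 1 : ℤ) : ℝ))
      rw [show x + ((-k - 1 : ℤ) : ℝ) + 1 = x + ((-k : ℤ) : ℝ) by push_cast; ring, ih] at this
      push_cast at this ⊢
      linarith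
  have hsurj : Function.Surjective h := by
    intro y
    obtain ⟨x, hx⟩ := QuotientAddGroup.mk_surjective (f.symm (y : S1))
    change (x : S1) = f.symm (y : S1) at hx
    have h₁ : ((h x : ℝ) : S1) = (y : S1) := by rw [hlift, hx, Equiv.apply_symm_apply]
    obtain ⟨z, hz⟩ := coe_S1_eq_iff.1 h₁
    exact ⟨x + z, by rw [hint, hz]⟩
  exact ⟨hmono.orderIsoOfSurjective h hsurj, hper, hlift⟩

theorem CircleOP.continuous {f : Equiv.Perm S1} (hf : CircleOP f) : Continuous f := by
  obtain ⟨h, -, hlift⟩ := hf.exists_orderIso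
  have hq : Topology.IsQuotientMap (fun x : ℝ => (x : S1)) := QuotientAddGroup.isQuotientMap_mk _
  rw [hq.continuous_iff]
  have : f ∘ (fun x : ℝ => (x : S1)) = (fun x : ℝ => (x : S1)) ∘ h := by
    ext x
    exact (hlift x).symm
  rw [this]
  exact continuous_coe_S1.comp h.continuous

theorem CircleOP.continuous_inv {f : Equiv.Perm S1} (hf : CircleOP f) :
    Continuous (f⁻¹ : Equiv.Perm S1) := by
  obtain ⟨h, -, hlift⟩ := hf.exists_orderIso
  have hq : Topology.IsQuotientMap (fun x : ℝ => (x : S1)) := QuotientAddGroup.isQuotientMap_mk _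
  rw [hq.continuous_iff]
  have : (f⁻¹ : Equiv.Perm S1) ∘ (fun x : ℝ => (x : S1)) =
      (fun x : ℝ => (x : S1)) ∘ h.symm := by
    ext x
    simp only [Function.comp]
    rw [Equiv.Perm.inv_eq_iff_eq, ← hlift, OrderIso.apply_symm_apply]
  rw [this]
  exact continuous_coe_S1.comp h.symm.continuous

theorem coe_zpow_apply {f : Equiv.Perm S1} {h : ℝ ≃o ℝ}
    (hlift : ∀ x : ℝ, ((h x : ℝ) : S1) = f (x : S1)) (m : ℤ) (x : ℝ) :
    (((h ^ m) x : ℝ) : S1) = (f ^ m) (x : S1) := by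
  induction m using Int.induction_on generalizing x with
  | zero => rfl
  | succ k ih =>
    rw [zpow_add_one, zpow_add_one]
    exact (ih (h x)).trans (by rw [hlift]; rfl)
  | pred k ih =>
    rw [zpow_sub_one, zpow_sub_one]
    refine (ih (h⁻¹ x)).trans ?_
    have : (((h⁻¹ : ℝ ≃o ℝ) x : ℝ) : S1) = f⁻¹ (x : S1) := by
      rw [Equiv.Perm.eq_inv_iff_eq, ← hlift]
      exact congrArg _ (h.apply_symm_apply x)
    rw [this]
    rfl

/-- A fixed-point free order isomorphism of an open interval moves every point past every other
point. -/
theorem exists_lt_pow_apply {h : ℝ ≃o ℝ} {s t : ℝ} (ht : h t = t)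
    (hlt : ∀ x ∈ Ioo s t, x < h x) {c d : ℝ} (hc : c ∈ Ioo s t) (hd : d < t) :
    ∃ m : ℕ, d < (h ^ m) c := by
  by_contra! hcon
  have hIoo : ∀ m : ℕ, (h ^ m) c ∈ Ioo s t := by
    intro m
    induction m with
    | zero => exact hc
    | succ k ih =>
      rw [pow_succ']
      change h ((h ^ k) c) ∈ _
      refine ⟨ih.1.trans (hlt _ ih), ?_⟩
      rw [← ht]
      exact h.strictMono ih.2
  have hbdd : BddAbove (range fun m : ℕ => (h ^ m) c) := ⟨d, by rintro _ ⟨m, rfl⟩; exact hcon m⟩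
  set L := ⨆ m : ℕ, (h ^ m) c with hL
  have hLd : L ≤ d := ciSup_le hcon
  have hcL : c ≤ L := le_ciSup hbdd 0
  have hLI : L ∈ Ioo s t := ⟨hc.1.trans_le hcL, hLd.trans_lt hd⟩
  have hsymm : h.symm L < L := by
    rw [← h.lt_iff_lt, h.apply_symm_apply]
    exact hlt L hLI
  obtain ⟨m, hm⟩ := exists_lt_of_lt_ciSup hsymm
  have h₁ : L < h ((h ^ m) c) := by
    rw [← h.lt_iff_lt, h.apply_symm_apply] at hm
    exact hm
  have h₂ : (h ^ (m + 1)) c ≤ L := le_ciSup hbdd (m + 1)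
  rw [pow_succ'] at h₂
  exact absurd h₁ (not_lt.2 h₂)

theorem exists_lt_zpow_apply {h : ℝ ≃o ℝ} {s t : ℝ} (hs : h s = s) (ht : h t = t)
    (hne : ∀ x ∈ Ioo s t, h x ≠ x) {c d : ℝ} (hc : c ∈ Ioo s t) (hd : d ∈ Ioo s t) :
    ∃ m : ℤ, d < (h ^ m) c := by
  have hside : (∀ x ∈ Ioo s t, x < h x) ∨ (∀ x ∈ Ioo s t, h x < x) := by
    by_contra! hcon
    obtain ⟨⟨x, hx, hxle⟩, ⟨y, hy, hyle⟩⟩ := hcon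
    have hpre : IsPreconnected (Ioo s t) := isPreconnected_Ioo
    obtain ⟨z, hz, hzeq⟩ := hpre.intermediate_value₂ hx hy h.continuous.continuousOn
      continuous_id.continuousOn hxle hyle
    exact hne z hz hzeq
  rcases hside with hlt | hlt
  · obtain ⟨m, hm⟩ := exists_lt_pow_apply ht hlt hc hd.2
    exact ⟨m, by simpa using hm⟩
  · have ht' : (h⁻¹ : ℝ ≃o ℝ) t = t := h.symm_apply_eq.2 ht.symm
    have hs' : (h⁻¹ : ℝ ≃o ℝ) s = s := h.symm_apply_eq.2 hs.symm
    have hlt' : ∀ x ∈ Ioo s t, x < (h⁻¹ : ℝ ≃o ℝ) x := by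
      intro x hx
      have h₁ : (h⁻¹ : ℝ ≃o ℝ) x ∈ Ioo s t := by
        constructor
        · exact hs'.symm.trans_lt ((h⁻¹ : ℝ ≃o ℝ).strictMono hx.1)
        · exact ((h⁻¹ : ℝ ≃o ℝ).strictMono hx.2).trans_eq ht'
      have h₂ := hlt _ h₁
      rwa [show h ((h⁻¹ : ℝ ≃o ℝ) x) = x from h.apply_symm_apply x] at h₂
    obtain ⟨m, hm⟩ := exists_lt_pow_apply ht' hlt' hc hd.2
    exact ⟨-m, by simpa using hm⟩

theorem pushes_of_supp {f : Equiv.Perm S1} (hf : CircleOP f) {s t : ℝ} (hst : s < t)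
    (hts : t ≤ s + 1) (hsupp : {y | f y ≠ y} = (fun x : ℝ => (x : S1)) '' Ioo s t) :
    Pushes f ((fun x : ℝ => (x : S1)) '' Ioo s t) s t ∧
      Pushes f ((fun x : ℝ => (x : S1)) '' Ioo s t) t s := by
  obtain ⟨h₀, hper₀, hlift₀⟩ := hf.exists_orderIso
  have hfix : ∀ x ∈ Icc s (s + 1), x ∉ Ioo s t → f (x : S1) = x := by
    intro x hx hxI
    by_contra hcon
    have : (x : S1) ∈ {y | f y ≠ y} := hcon
    rw [hsupp, coe_mem_image_Ioo_iff le_rfl hts hx] at this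
    exact hxI this
  have hfs : f (s : S1) = s := hfix s ⟨le_rfl, by linarith⟩ (fun h => lt_irrefl _ h.1)
  have hft : f (t : S1) = t := hfix t ⟨hst.le, hts⟩ (fun h => lt_irrefl _ h.2)
  obtain ⟨h, hper, hlift, hhs⟩ : ∃ h : ℝ ≃o ℝ, (∀ x, h (x + 1) = h x + 1) ∧
      (∀ x : ℝ, ((h x : ℝ) : S1) = f (x : S1)) ∧ h s = s := by
    obtain ⟨z, hz⟩ := coe_S1_eq_iff.1 ((hlift₀ s).trans hfs)
    refine ⟨h₀.trans (OrderIso.addRight (z : ℝ)), fun x => ?_, fun x => ?_, ?_⟩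
    · simp [hper₀]; ring
    · simp only [OrderIso.trans_apply, OrderIso.addRight_apply]
      rw [← hlift₀, eq_comm, coe_S1_eq_iff]
      exact ⟨z, rfl⟩
    · simp [← hz]
  have hht : h t = t := by
    have h₁ : s < h t := by
      rw [← hhs]
      exact h.strictMono hst
    have h₂ : h t ≤ s + 1 := by
      rw [show s + 1 = h (s + 1) by rw [hper, hhs]]
      exact h.monotone hts
    exact eq_of_coe_S1_eq ((hlift t).trans hft) (by linarith) (by linarith)
  have hne : ∀ x ∈ Ioo s t, h x ≠ x := by
    intro x hx hcon
    have h₁ : (x : S1) ∈ {y | f y ≠ y} := by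
      rw [hsupp]
      exact ⟨x, hx, rfl⟩
    exact h₁ (by rw [← hlift, hcon])
  have hzs : ∀ m : ℤ, (h ^ m) s = s := fun m => by
    have : h ∈ MulAction.stabilizer (ℝ ≃o ℝ) s := hhs
    exact (zpow_mem this m : _)
  have hzt : ∀ m : ℤ, (h ^ m) t = t := fun m => by
    have : h ∈ MulAction.stabilizer (ℝ ≃o ℝ) t := hht
    exact (zpow_mem this m : _)
  have hright : ∀ V : Set S1, IsOpen V → (s : S1) ∈ V →
      ∃ c ∈ Ioo s t, ∀ x ∈ Ioo s t, x ≤ c → (x : S1) ∈ V := by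
    intro V hV hsV
    obtain ⟨ε, hε, hball⟩ := Metric.isOpen_iff.1 (hV.preimage continuous_coe_S1) s hsV
    rw [Real.ball_eq_Ioo] at hball
    obtain ⟨c, hc, hc'⟩ := exists_between (show s < min t (s + ε) by
      rw [lt_min_iff]; constructor <;> linarith)
    rw [lt_min_iff] at hc'
    exact ⟨c, ⟨hc, hc'.1⟩, fun x hx hxc => hball ⟨by linarith [hx.1], by linarith [hc'.2]⟩⟩
  have hleft : ∀ V : Set S1, IsOpen V → (t : S1) ∈ V →
      ∃ c ∈ Ioo s t, ∀ x ∈ Ioo s t, c ≤ x → (x : S1) ∈ V := by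
    intro V hV htV
    obtain ⟨ε, hε, hball⟩ := Metric.isOpen_iff.1 (hV.preimage continuous_coe_S1) t htV
    rw [Real.ball_eq_Ioo] at hball
    obtain ⟨c, hc, hc'⟩ := exists_between (show max s (t - ε) < t by
      rw [max_lt_iff]; constructor <;> linarith)
    rw [max_lt_iff] at hc
    exact ⟨c, ⟨hc.1, hc'⟩, fun x hx hxc => hball ⟨by linarith [hc.2], by linarith [hx.2]⟩⟩
  have hIoo : ∀ (m : ℤ), ∀ x ∈ Ioo s t, (h ^ m) x ∈ Ioo s t := by
    intro m x hx
    constructor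
    · rw [← hzs m]
      exact (h ^ m).strictMono hx.1
    · rw [← hzt m]
      exact (h ^ m).strictMono hx.2
  constructor
  · intro C hC hsC W hW htW
    obtain ⟨c, hc, hcC⟩ := hright Cᶜ hC.isOpen_compl hsC
    obtain ⟨d, hd, hdW⟩ := hleft W hW htW
    obtain ⟨m, hm⟩ := exists_lt_zpow_apply hhs hht hne hc hd
    refine ⟨m, ?_⟩
    rintro _ ⟨hyC, x, hx, rfl⟩
    rw [← coe_zpow_apply hlift]
    refine hdW _ (hIoo m x hx) (hm.le.trans ((h ^ m).monotone ?_))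
    by_contra hcon
    exact hcC x hx (not_le.1 hcon).le hyC
  · intro C hC htC W hW hsW
    obtain ⟨c, hc, hcC⟩ := hleft Cᶜ hC.isOpen_compl htC
    obtain ⟨d, hd, hdW⟩ := hright W hW hsW
    obtain ⟨m, hm⟩ := exists_lt_zpow_apply hhs hht hne hd hc
    refine ⟨-m, ?_⟩
    rintro _ ⟨hyC, x, hx, rfl⟩
    rw [← coe_zpow_apply hlift]
    refine hdW _ (hIoo (-m) x hx) ?_
    have hxc : x ≤ c := by
      by_contra hcon
      exact hcC x hx (not_le.1 hcon).le hyC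
    rw [zpow_neg]
    exact ((h ^ m).symm_apply_le).2 (hxc.trans hm.le)

end Dynamics

section Overlap

/-- Two overlapping arcs `A`, `B` that carry homeomorphisms `f`, `g`: the arc `A` has the end `a`
inside `B` and the other end `a'` away from `B`, and the arc `B` has the end `b` inside `A` and the
other end `b'` away from `A`. -/
structure Overlap (f g : Equiv.Perm S1) (A B : Set S1) (a a' b b' : S1) : Prop where
  a_mem : a ∈ B
  a_notMem : a ∉ A
  b_mem : b ∈ A
  b_notMem : b ∉ B
  a'_notMem_left : a' ∉ A
  a'_notMem_right : a' ∉ B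
  b'_notMem_left : b' ∉ A
  b'_notMem_right : b' ∉ B
  a'_notMem_closure : a' ∉ closure (A ∩ B)
  b'_notMem_closure : b' ∉ closure (A ∩ B)
  a'_mem_closure : a' ∈ closure A
  b'_mem_closure : b' ∈ closure B
  push_left : Pushes f A a a'
  push_left' : Pushes f A a' a
  push_right : Pushes g B b b'
  push_right' : Pushes g B b' b

theorem Overlap.symm {f g : Equiv.Perm S1} {A B : Set S1} {a a' b b' : S1}
    (h : Overlap f g A B a a' b b') : Overlap g f B A b b' a a' where
  a_mem := h.b_mem
  a_notMem := h.b_notMem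
  b_mem := h.a_mem
  b_notMem := h.a_notMem
  a'_notMem_left := h.b'_notMem_right
  a'_notMem_right := h.b'_notMem_left
  b'_notMem_left := h.a'_notMem_right
  b'_notMem_right := h.a'_notMem_left
  a'_notMem_closure := inter_comm A B ▸ h.b'_notMem_closure
  b'_notMem_closure := inter_comm A B ▸ h.a'_notMem_closure
  a'_mem_closure := h.b'_mem_closure
  b'_mem_closure := h.a'_mem_closure
  push_left := h.push_right
  push_left' := h.push_right'
  push_right := h.push_left
  push_right' := h.push_left'

theorem closure_coe_image_inter_subset {p c d c' d' : ℝ} (hcp : p ≤ c)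
    (hd : d ≤ p + 1) (hcp' : p ≤ c') (hd' : d' ≤ p + 1) :
    closure ((fun x : ℝ => (x : S1)) '' Ioo c d ∩ (fun x : ℝ => (x : S1)) '' Ioo c' d') ⊆
      (fun x : ℝ => (x : S1)) '' Icc c' d := by
  refine closure_minimal ?_ (isCompact_Icc.image continuous_coe_S1).isClosed
  rintro _ ⟨⟨x, hx, rfl⟩, hx'⟩
  have := (coe_mem_image_Ioo_iff hcp' hd' ⟨by linarith [hx.1], by linarith [hx.2]⟩).1 hx'
  exact ⟨x, ⟨this.1.le, hx.2.le⟩, rfl⟩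

theorem coe_mem_closure_image_Ioo {c d : ℝ} (h : c < d) {x : ℝ} (hx : x ∈ Icc c d) :
    (x : S1) ∈ closure ((fun x : ℝ => (x : S1)) '' Ioo c d) := by
  rw [← closure_Ioo h.ne] at hx
  exact image_closure_subset_closure_image continuous_coe_S1 ⟨x, hx, rfl⟩

theorem overlap_of_lt {f g : Equiv.Perm S1} (hf : CircleOP f) (hg : CircleOP g)
    {p α α' β β' : ℝ} (h₁ : p ≤ α) (h₂ : α < β) (h₃ : β < α') (h₄ : α' < β') (h₅ : β' ≤ p + 1)
    (hfs : {y | f y ≠ y} = (fun x : ℝ => (x : S1)) '' Ioo α α')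
    (hgs : {y | g y ≠ y} = (fun x : ℝ => (x : S1)) '' Ioo β β') :
    Overlap f g ((fun x : ℝ => (x : S1)) '' Ioo α α') ((fun x : ℝ => (x : S1)) '' Ioo β β')
      α' α β β' := by
  have hA : ∀ x ∈ Icc p (p + 1), ((x : S1) ∈ (fun x : ℝ => (x : S1)) '' Ioo α α' ↔ x ∈ Ioo α α') :=
    fun x hx => coe_mem_image_Ioo_iff (by linarith) (by linarith) hx
  have hB : ∀ x ∈ Icc p (p + 1), ((x : S1) ∈ (fun x : ℝ => (x : S1)) '' Ioo β β' ↔ x ∈ Ioo β β') :=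
    fun x hx => coe_mem_image_Ioo_iff (by linarith) (by linarith) hx
  have hcl := closure_coe_image_inter_subset (p := p) (c := α) (d := α') (c' := β) (d' := β')
    (by linarith) (by linarith) (by linarith) (by linarith)
  have hC : ∀ x ∈ Icc p (p + 1), x ∉ Icc β α' → (x : S1) ∉
      closure ((fun x : ℝ => (x : S1)) '' Ioo α α' ∩ (fun x : ℝ => (x : S1)) '' Ioo β β') :=
    fun x hx hn h => hn ((coe_mem_image_Icc_iff (by linarith) (by linarith) hx).1 (hcl h))
  have iα : α ∈ Icc p (p + 1) := ⟨by linarith, by linarith⟩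
  have iα' : α' ∈ Icc p (p + 1) := ⟨by linarith, by linarith⟩
  have iβ : β ∈ Icc p (p + 1) := ⟨by linarith, by linarith⟩
  have iβ' : β' ∈ Icc p (p + 1) := ⟨by linarith, by linarith⟩
  have pf := pushes_of_supp hf (by linarith) (by linarith) hfs
  have pg := pushes_of_supp hg (by linarith) (by linarith) hgs
  constructor
  · exact (hB _ iα').2 ⟨h₃, h₄⟩
  · exact fun h => lt_irrefl _ ((hA _ iα').1 h).2
  · exact (hA _ iβ).2 ⟨h₂, h₃⟩
  · exact fun h => lt_irrefl _ ((hB _ iβ).1 h).1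
  · exact fun h => lt_irrefl _ ((hA _ iα).1 h).1
  · exact fun h => lt_asymm h₂ ((hB _ iα).1 h).1
  · exact fun h => lt_asymm h₄ ((hA _ iβ').1 h).2
  · exact fun h => lt_irrefl _ ((hB _ iβ').1 h).2
  · exact hC _ iα fun h => absurd h.1 (not_le.2 h₂)
  · exact hC _ iβ' fun h => absurd h.2 (not_le.2 h₄)
  · exact coe_mem_closure_image_Ioo (by linarith) ⟨le_rfl, by linarith⟩
  · exact coe_mem_closure_image_Ioo (by linarith) ⟨by linarith, le_rfl⟩
  · exact pf.2
  · exact pf.1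
  · exact pg.1
  · exact pg.2

theorem exists_overlap {f g : Equiv.Perm S1} (hf : CircleOP f) (hg : CircleOP g)
    {A B : Set S1} (hAo : IsOpen A) (hBo : IsOpen B) (hA : IsConnected A) (hB : IsConnected B)
    (hAu : A ≠ univ) (hBu : B ≠ univ) (hABc : IsConnected (A ∩ B)) (hAB : ¬A ⊆ B) (hBA : ¬B ⊆ A)
    (hfs : {y | f y ≠ y} = A) (hgs : {y | g y ≠ y} = B) :
    ∃ a a' b b', Overlap f g A B a a' b b' := by
  obtain ⟨q, hq⟩ := (ne_univ_iff_exists_notMem _).1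
    (union_ne_univ_of_isPreconnected_inter hAo hBo hB hAu hBu hABc.isPreconnected)
  obtain ⟨p, rfl⟩ := QuotientAddGroup.mk_surjective q
  change (p : S1) ∉ A ∪ B at hq
  obtain ⟨α, α', hα, hαα, hα', rfl⟩ := exists_eq_image_Ioo hAo hA (fun h => hq (Or.inl h))
  obtain ⟨β, β', hβ, hββ, hβ', rfl⟩ := exists_eq_image_Ioo hBo hB (fun h => hq (Or.inr h))
  obtain ⟨_, ⟨x, hx, rfl⟩, hxB⟩ := hABc.nonempty
  have hx' := (coe_mem_image_Ioo_iff hβ hβ' ⟨by linarith [hx.1], by linarith [hx.2]⟩).1 hxB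
  have h₁ : ¬(β ≤ α ∧ α' ≤ β') := fun h => hAB (image_mono (Ioo_subset_Ioo h.1 h.2))
  have h₂ : ¬(α ≤ β ∧ β' ≤ α') := fun h => hBA (image_mono (Ioo_subset_Ioo h.1 h.2))
  rcases lt_or_ge α β with h | h
  · have h₃ : α' < β' := by
      by_contra hcon
      exact h₂ ⟨h.le, not_lt.1 hcon⟩
    exact ⟨_, _, _, _, overlap_of_lt hf hg hα h (hx'.1.trans hx.2) h₃ hβ' hfs hgs⟩
  · have h₃ : β' < α' := by
      by_contra hcon
      exact h₁ ⟨h, not_lt.1 hcon⟩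
    have h₄ : β < α := by
      by_contra hcon
      exact h₂ ⟨not_lt.1 hcon, h₃.le⟩
    exact ⟨_, _, _, _, (overlap_of_lt hg hf hβ h₄ (hx.1.trans hx'.2) h₃ hα' hgs hfs).symm⟩

end Overlap

section Contraction

theorem zpow_apply_eq_self {f : Equiv.Perm S1} {J : Set S1} (hf : {y | f y ≠ y} = J) {y : S1}
    (hy : y ∉ J) (m : ℤ) : (f ^ m) y = y := by
  refine Equiv.Perm.zpow_apply_eq_self_of_apply_eq_self ?_ m
  by_contra h
  exact hy (hf ▸ h)

theorem zpow_apply_mem {f : Equiv.Perm S1} {J : Set S1} (hf : {y | f y ≠ y} = J) {y : S1}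
    (hy : y ∈ J) (m : ℤ) : (f ^ m) y ∈ J := by
  by_contra h
  have h₁ := zpow_apply_eq_self hf h (-m)
  rw [← Equiv.Perm.mul_apply, ← zpow_add] at h₁
  simp only [neg_add_cancel, zpow_zero, Equiv.Perm.coe_one, id_eq] at h₁
  exact h (h₁ ▸ hy)

/-- Some element of `G` moves `C` into any prescribed nonempty open set. -/
def Contracts (G : Subgroup (Equiv.Perm S1)) (C : Set S1) : Prop :=
  ∀ U : Set S1, IsOpen U → U.Nonempty → ∃ g ∈ G, ∀ y ∈ C, g y ∈ U

theorem Contracts.of_mapsTo {G : Subgroup (Equiv.Perm S1)} {C D : Set S1} (hD : Contracts G D)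
    {g : Equiv.Perm S1} (hg : g ∈ G) (h : ∀ y ∈ C, g y ∈ D) : Contracts G C := by
  intro U hU hne
  obtain ⟨k, hk, hkU⟩ := hD U hU hne
  exact ⟨k * g, mul_mem hk hg, fun y hy => hkU _ (h y hy)⟩

theorem Contracts.mono {G : Subgroup (Equiv.Perm S1)} {C D : Set S1} (hD : Contracts G D)
    (h : C ⊆ D) : Contracts G C :=
  hD.of_mapsTo (one_mem G) fun _ hy => h hy

theorem MinimalAct.exists_apply_mem {G : Subgroup (Equiv.Perm S1)} (hG : MinimalAct G) (p : S1)
    {U : Set S1} (hU : IsOpen U) (hne : U.Nonempty) : ∃ g ∈ G, g p ∈ U := by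
  obtain ⟨q, hqU, g, hg, rfl⟩ := (hG p).inter_open_nonempty U hU hne
  exact ⟨g, hg, hqU⟩

theorem Pushes.contracts {G : Subgroup (Equiv.Perm S1)} (hG : MinimalAct G)
    (hcont : ∀ g ∈ G, Continuous g) {f : Equiv.Perm S1} (hfG : f ∈ G) {J : Set S1} {s t : S1}
    (hp : Pushes f J s t) {C : Set S1} (hC : IsClosed C) (hCJ : C ⊆ J) (hs : s ∉ C) :
    Contracts G C := by
  intro U hU hne
  obtain ⟨g, hg, hgt⟩ := hG.exists_apply_mem t hU hne
  obtain ⟨m, hm⟩ := hp C hC hs (g ⁻¹' U) (hU.preimage (hcont g hg)) hgt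
  exact ⟨g * f ^ m, mul_mem hg (zpow_mem hfG m), fun y hy => hm y ⟨hy, hCJ hy⟩⟩

/-- A closed set `C` missing the end `s` of `J` contracts as soon as the set obtained from it by
collapsing `J` to the end `t` does. -/
theorem Pushes.contracts_of_collapse {G : Subgroup (Equiv.Perm S1)}
    (hcont : ∀ g ∈ G, Continuous g) {U₀ : Set S1} (hU₀ : IsOpen U₀) (hU₀ne : U₀.Nonempty)
    (hU₀c : Contracts G U₀) {f : Equiv.Perm S1} (hfG : f ∈ G) {J : Set S1}
    (hf : {y | f y ≠ y} = J) {s t : S1} (hp : Pushes f J s t) {C : Set S1} (hC : IsClosed C)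
    (hs : s ∉ C) (hcol : Contracts G (C \ J ∪ {t})) : Contracts G C := by
  obtain ⟨g, hg, hgU⟩ := hcol U₀ hU₀ hU₀ne
  obtain ⟨m, hm⟩ := hp C hC hs (g ⁻¹' U₀) (hU₀.preimage (hcont g hg)) (hgU t (Or.inr rfl))
  refine hU₀c.of_mapsTo (mul_mem hg (zpow_mem hfG m)) fun y hy => ?_
  rw [Equiv.Perm.mul_apply]
  by_cases hyJ : y ∈ J
  · exact hm y ⟨hy, hyJ⟩
  · rw [zpow_apply_eq_self hf hyJ]
    exact hgU y (Or.inl ⟨hy, hyJ⟩)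

/-- Some composition of powers of `f` and `g` moves `A` into any neighbourhood of its end `a'`. -/
theorem Overlap.exists_shrink {f g : Equiv.Perm S1} {A B : Set S1} {a a' b b' : S1}
    (h : Overlap f g A B a a' b b') (hA : IsOpen A) (hB : IsOpen B) (hf : {y | f y ≠ y} = A)
    (hg : {y | g y ≠ y} = B) {V : Set S1} (hV : IsOpen V) (ha' : a' ∈ V) :
    ∃ M m : ℤ, ∀ y ∈ A, (f ^ M * g ^ m) y ∈ V ∩ A := by
  obtain ⟨Q, hQ, hQc, hQA⟩ := exists_mem_nhds_isClosed_subset (hA.mem_nhds h.b_mem)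
  obtain ⟨m, hm⟩ := h.push_right' _ isClosed_closure h.b'_notMem_closure (interior Q)
    isOpen_interior (mem_interior_iff_mem_nhds.2 hQ)
  have haZ : a ∉ closure (A \ B) ∪ Q := by
    rintro (haZ | haQ)
    · obtain ⟨y, hyB, -, hy⟩ := mem_closure_iff.1 haZ B hB h.a_mem
      exact hy hyB
    · exact h.a_notMem (hQA haQ)
  obtain ⟨M, hM⟩ := h.push_left _ (isClosed_closure.union hQc) haZ V hV ha'
  refine ⟨M, m, fun y hy => ?_⟩
  have key : (g ^ m) y ∈ (closure (A \ B) ∪ Q) ∩ A := by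
    by_cases hyB : y ∈ B
    · have h₁ := interior_subset (hm y ⟨subset_closure ⟨hy, hyB⟩, hyB⟩)
      exact ⟨Or.inr h₁, hQA h₁⟩
    · rw [zpow_apply_eq_self hg hyB]
      exact ⟨Or.inl (subset_closure ⟨hy, hyB⟩), hy⟩
  exact ⟨hM _ key, zpow_apply_mem hf key.2 M⟩

variable {n : ℕ} (R : FastRing n)

theorem FastRing.exists_overlap (i : ZMod n) : ∃ a a' b b',
    Overlap (R.f i) (R.f (i + 1)) (R.J i) (R.J (i + 1)) a a' b b' := by
  refine _root_.exists_overlap (R.orient i) (R.orient (i + 1)) (R.isOpen' i) (R.isOpen' (i + 1))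
    (R.isConn i) (R.isConn (i + 1)) (R.proper i) (R.proper (i + 1)) (R.adj_conn i) ?_ ?_
    (R.supp i) (R.supp (i + 1))
  · exact fun h => (R.adj_ssub_left i).2 fun y hy => ⟨hy, h hy⟩
  · exact fun h => (R.adj_ssub_right i).2 fun y hy => ⟨h hy, hy⟩

theorem FastRing.mem_Gn (i : ZMod n) : R.f i ∈ Gn R := Subgroup.subset_closure ⟨i, rfl⟩

theorem continuous_of_mem_Gn {g : Equiv.Perm S1} (hg : g ∈ Gn R) : Continuous g := by
  suffices Continuous g ∧ Continuous (g⁻¹ : Equiv.Perm S1) from this.1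
  induction hg using Subgroup.closure_induction with
  | mem g hg =>
    obtain ⟨i, rfl⟩ := hg
    exact ⟨(R.orient i).continuous, (R.orient i).continuous_inv⟩
  | one => exact ⟨continuous_id, by rw [inv_one]; exact continuous_id⟩
  | mul x y _ _ hx hy => exact ⟨hx.1.comp hy.1, by rw [mul_inv_rev]; exact hy.2.comp hx.2⟩
  | inv x _ hx => exact ⟨hx.2, by rw [inv_inv]; exact hx.1⟩

variable {R}

theorem FastRing.exists_contracts_isOpen (hmin : MinimalAct (Gn R)) :
    ∃ U : Set S1, IsOpen U ∧ U.Nonempty ∧ Contracts (Gn R) U := by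
  obtain ⟨a, a', b, b', h⟩ := R.exists_overlap 0
  obtain ⟨x, hx⟩ := (R.isConn 0).nonempty
  obtain ⟨Q, hQ, hQc, hQJ⟩ := exists_mem_nhds_isClosed_subset ((R.isOpen' 0).mem_nhds hx)
  exact ⟨interior Q, isOpen_interior, ⟨x, mem_interior_iff_mem_nhds.2 hQ⟩,
    (h.push_left.contracts hmin (fun _ => continuous_of_mem_Gn R) (R.mem_Gn 0) hQc hQJ
      fun ha => h.a_notMem (hQJ ha)).mono interior_subset⟩

theorem FastRing.contracts_compl_initial (hn : 2 ≤ n) (hmin : MinimalAct (Gn R)) (k : ℕ)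
    (hk : k + 2 ≤ n) : Contracts (Gn R) {y | ∀ j : ℕ, j ≤ k → y ∉ R.J (j : ZMod n)} := by
  have : NeZero n := ⟨by omega⟩
  have hclosed : ∀ k : ℕ, IsClosed {y | ∀ j : ℕ, j ≤ k → y ∉ R.J (j : ZMod n)} := by
    intro k
    simp only [ofPred_forall]
    exact isClosed_iInter fun j => isClosed_iInter fun _ => (R.isOpen' _).isClosed_compl
  obtain ⟨U₀, hU₀, hU₀ne, hU₀c⟩ := FastRing.exists_contracts_isOpen hmin
  obtain ⟨d, hd⟩ : ∃ d, k + 2 + d = n := ⟨n - (k + 2), by omega⟩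
  induction d generalizing k with
  | zero =>
    obtain ⟨a, a', b, b', h⟩ := R.exists_overlap ((k + 1 : ℕ) : ZMod n)
    have hsub : {y | ∀ j : ℕ, j ≤ k → y ∉ R.J (j : ZMod n)} ⊆ R.J ((k + 1 : ℕ) : ZMod n) := by
      intro y hy
      obtain ⟨i, hi⟩ := mem_iUnion.1 (R.covers ▸ mem_univ y : y ∈ ⋃ i, R.J i)
      have hlt := ZMod.val_lt i
      have hval : ¬i.val ≤ k := fun hle => hy _ hle (by rwa [ZMod.natCast_zmod_val])
      rwa [show k + 1 = i.val by omega, ZMod.natCast_zmod_val]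
    exact h.push_left.contracts hmin (fun _ => continuous_of_mem_Gn R) (R.mem_Gn _) (hclosed k)
      hsub fun ha => h.a_notMem (hsub ha)
  | succ d ih =>
    obtain ⟨a, a', b, b', h⟩ := R.exists_overlap (k : ZMod n)
    refine h.push_right.contracts_of_collapse (fun _ => continuous_of_mem_Gn R) hU₀ hU₀ne hU₀c
      (R.mem_Gn _) (R.supp _) (hclosed k) (fun hb => hb k le_rfl h.b_mem)
      ((ih (k + 1) (by omega) (by omega)).mono ?_)
    rintro y (⟨hy, hyJ⟩ | rfl) j hj
    · rcases Nat.le_succ_iff.1 hj with hj | rfl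
      · exact hy j hj
      · rwa [Nat.cast_succ]
    · intro hyj
      rcases Nat.lt_or_ge j k with hjk | hjk
      · have hcast : ∀ a b : ℕ, a < n → b < n → ((a : ℕ) : ZMod n) = b → a = b := by
          intro a b ha hb hab
          rwa [ZMod.natCast_eq_natCast_iff', Nat.mod_eq_of_lt ha, Nat.mod_eq_of_lt hb] at hab
        have hdisj : R.J (j : ZMod n) ∩ R.J ((k : ZMod n) + 1) = ∅ := by
          apply R.disj
          · intro he
            have := hcast j (k + 1) (by omega) (by omega) (by push_cast; exact he)
            omega
          · intro he
            have h₁ : ((j : ℕ) : ZMod n) = ((k + 2 : ℕ) : ZMod n) := by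
              rw [sub_eq_iff_eq_add] at he
              rw [he]
              push_cast
              ring
            have := hcast j (k + 2) (by omega) (by omega) h₁
            omega
          · intro he
            have h₁ : ((k : ℕ) : ZMod n) = ((j : ℕ) : ZMod n) := by
              linear_combination he
            have := hcast k j (by omega) (by omega) h₁
            omega
        obtain ⟨z, hzj, hz⟩ := mem_closure_iff.1 h.b'_mem_closure _ (R.isOpen' _) hyj
        exact (hdisj ▸ (⟨hzj, hz⟩ : z ∈ R.J (j : ZMod n) ∩ R.J ((k : ZMod n) + 1)) :
          z ∈ (∅ : Set S1))
      · rcases Nat.lt_or_ge k j with hkj | hkj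
        · rw [show j = k + 1 by omega, Nat.cast_succ] at hyj
          exact h.b'_notMem_right hyj
        · rw [show j = k by omega] at hyj
          exact h.b'_notMem_left hyj

theorem FastRing.contracts_of_isClosed (hn : 2 ≤ n) (hmin : MinimalAct (Gn R)) {C : Set S1}
    (hC : IsClosed C) (hCu : C ≠ univ) : Contracts (Gn R) C := by
  obtain ⟨U₀, hU₀, hU₀ne, hU₀c⟩ := FastRing.exists_contracts_isOpen hmin
  obtain ⟨a, a', b, b', h⟩ := R.exists_overlap 0
  obtain ⟨g, hg, hga⟩ := hmin.exists_apply_mem a hC.isOpen_compl (nonempty_compl.2 hCu)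
  refine Contracts.of_mapsTo (D := g ⁻¹' C) ?_ (inv_mem hg) (fun y hy => by simpa using hy)
  refine h.push_left.contracts_of_collapse (fun _ => continuous_of_mem_Gn R) hU₀ hU₀ne hU₀c
      (R.mem_Gn _) (R.supp _) (hC.preimage (continuous_of_mem_Gn R hg)) hga
      ((FastRing.contracts_compl_initial hn hmin 0 (by omega)).mono ?_)
  rintro y hy j hj
  obtain rfl : j = 0 := by omega
  rw [Nat.cast_zero]
  rcases hy with hy | rfl
  · exact hy.2
  · exact h.a'_notMem_left

theorem FastRing.contracts_J (hmin : MinimalAct (Gn R)) (i : ZMod n) :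
    Contracts (Gn R) (R.J i) := by
  intro U hU hne
  obtain ⟨a, a', b, b', h⟩ := R.exists_overlap i
  obtain ⟨g, hg, hga⟩ := hmin.exists_apply_mem a' hU hne
  obtain ⟨M, m, hMm⟩ := h.exists_shrink (R.isOpen' _) (R.isOpen' _) (R.supp _) (R.supp _)
    (hU.preimage (continuous_of_mem_Gn R hg)) hga
  exact ⟨g * (R.f i ^ M * R.f (i + 1) ^ m), mul_mem hg (mul_mem (zpow_mem (R.mem_Gn _) _)
    (zpow_mem (R.mem_Gn _) _)), fun y hy => (hMm y hy).1⟩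

end Contraction

section Derived

open scoped commutatorElement

variable {n : ℕ} {R : FastRing n}

theorem Hn_le_Gn : Hn R ≤ Gn R :=
  Subgroup.commutator_le.2 fun _ ha _ hb =>
    mul_mem (mul_mem (mul_mem ha hb) (inv_mem ha)) (inv_mem hb)

theorem conj_mem_Hn {g h : Equiv.Perm S1} (hg : g ∈ Gn R) (hh : h ∈ Hn R) :
    g * h * g⁻¹ ∈ Hn R := by
  have h₁ : ⁅g, h⁆ ∈ Hn R := Subgroup.commutator_mem_commutator hg (Hn_le_Gn hh)
  have h₂ : g * h * g⁻¹ = ⁅g, h⁆ * h := by group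
  rw [h₂]
  exact mul_mem h₁ hh

/-- Every element of `Gn R` is corrected to an element of `Hn R` by an element supported in any
prescribed nonempty open set. -/
theorem FastRing.exists_mul_mem_Hn (hmin : MinimalAct (Gn R)) {V : Set S1} (hV : IsOpen V)
    (hVne : V.Nonempty) {g : Equiv.Perm S1} (hg : g ∈ Gn R) :
    ∃ g' ∈ Gn R, (∀ y ∉ V, g' y = y) ∧ g * g' ∈ Hn R := by
  induction hg using Subgroup.closure_induction with
  | mem g hg =>
    obtain ⟨i, rfl⟩ := hg
    obtain ⟨k, hk, hkV⟩ := FastRing.contracts_J hmin i V hV hVne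
    refine ⟨k * (R.f i)⁻¹ * k⁻¹, mul_mem (mul_mem hk (inv_mem (R.mem_Gn i))) (inv_mem hk),
      fun y hy => ?_, ?_⟩
    · have h₁ : k⁻¹ y ∉ R.J i := fun h => hy (by simpa using hkV _ h)
      have h₂ := zpow_apply_eq_self (R.supp i) h₁ (-1)
      rw [zpow_neg_one] at h₂
      rw [Equiv.Perm.mul_apply, Equiv.Perm.mul_apply, h₂]
      simp
    · rw [show R.f i * (k * (R.f i)⁻¹ * k⁻¹) = ⁅R.f i, k⁆ by group]
      exact Subgroup.commutator_mem_commutator (R.mem_Gn i) hk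
  | one => exact ⟨1, one_mem _, fun _ _ => rfl, by simp⟩
  | mul x y hx hy ihx ihy =>
    obtain ⟨x', hx', hxV, hxH⟩ := ihx
    obtain ⟨y', hy', hyV, hyH⟩ := ihy
    refine ⟨y' * x', mul_mem hy' hx', fun z hz => ?_, ?_⟩
    · rw [Equiv.Perm.mul_apply, hxV z hz, hyV z hz]
    · rw [show x * y * (y' * x') = x * (y * y') * x⁻¹ * (x * x') by group]
      exact mul_mem (conj_mem_Hn hx hyH) hxH
  | inv x hx ihx =>
    obtain ⟨x', hx', hxV, hxH⟩ := ihx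
    refine ⟨x'⁻¹, inv_mem hx', fun z hz => Equiv.Perm.inv_eq_iff_eq.2 (hxV z hz).symm, ?_⟩
    rw [show x⁻¹ * x'⁻¹ = (x⁻¹ * (x * x') * x⁻¹⁻¹)⁻¹ by group]
    exact inv_mem (conj_mem_Hn (inv_mem hx) hxH)

theorem FastRing.contracts_Hn_of_isClosed (hn : 2 ≤ n) (hmin : MinimalAct (Gn R)) {C : Set S1}
    (hC : IsClosed C) (hCu : C ≠ univ) : Contracts (Hn R) C := by
  intro U hU hne
  obtain ⟨g, hg, hgU⟩ := FastRing.contracts_of_isClosed hn hmin hC hCu U hU hne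
  obtain ⟨g', hg', hgC, hgH⟩ := FastRing.exists_mul_mem_Hn hmin hC.isOpen_compl
    (nonempty_compl.2 hCu) hg
  refine ⟨g * g', hgH, fun y hy => ?_⟩
  rw [Equiv.Perm.mul_apply, hgC y (not_not.2 hy)]
  exact hgU y hy

end Derived

section Simplicity

open scoped commutatorElement

theorem exists_disjoint_isOpen_subset {U : Set S1} (hU : IsOpen U) (hne : U.Nonempty) :
    ∃ U₁ U₂ : Set S1, IsOpen U₁ ∧ IsOpen U₂ ∧ U₁.Nonempty ∧ U₂.Nonempty ∧ U₁ ⊆ U ∧ U₂ ⊆ U ∧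
      Disjoint U₁ U₂ := by
  obtain ⟨x, hx⟩ := hne
  have : Nontrivial S1 := ⟨((0 : ℝ) : S1), ((1 / 2 : ℝ) : S1), fun h => by
    have := eq_of_coe_S1_eq h (by norm_num) (by norm_num)
    norm_num at this⟩
  obtain ⟨y, hy, hyx⟩ := (infinite_of_mem_nhds x (hU.mem_nhds hx)).exists_notMem_finite
    (finite_singleton x)
  obtain ⟨V₁, V₂, hV₁, hV₂, hx₁, hy₂, hd⟩ := t2_separation (show y ≠ x from hyx)
  exact ⟨V₁ ∩ U, V₂ ∩ U, hV₁.inter hU, hV₂.inter hU, ⟨y, hx₁, hy⟩, ⟨x, hy₂, hx⟩,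
    inter_subset_right, inter_subset_right, hd.mono inter_subset_left inter_subset_left⟩

/-- Near a point off both arcs and off the closure of their intersection, conjugating `f` by a
composition of powers of `f` and `g` does not change it. -/
theorem exists_isOpen_mul_conj_inv_apply {f g : Equiv.Perm S1} (hfc : ∀ m : ℤ, Continuous (f ^ m))
    (hgc : ∀ m : ℤ, Continuous (g ^ m)) {A B : Set S1} (hf : {y | f y ≠ y} = A)
    (hg : {y | g y ≠ y} = B) {p : S1} (hpA : p ∉ A) (hpB : p ∉ B) (hp : p ∉ closure (A ∩ B))
    (M m : ℤ) : ∃ W : Set S1, IsOpen W ∧ p ∈ W ∧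
      ∀ y ∈ W, (f * ((f ^ M * g ^ m) * f * (f ^ M * g ^ m)⁻¹)⁻¹) y = y := by
  set W₀ := (closure (A ∩ B))ᶜ with hW₀
  have hW₀o : IsOpen W₀ := isClosed_closure.isOpen_compl
  have hnB : ∀ y ∈ W₀, y ∈ A → y ∉ B := fun y hy hyA hyB => hy (subset_closure ⟨hyA, hyB⟩)
  refine ⟨W₀ ∩ (f ^ (-M)) ⁻¹' W₀ ∩ (f ^ (-1 - M)) ⁻¹' W₀ ∩ (g ^ (-m)) ⁻¹' W₀,
    ((hW₀o.inter (hW₀o.preimage (hfc _))).inter (hW₀o.preimage (hfc _))).inter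
      (hW₀o.preimage (hgc _)), ⟨⟨⟨hp, ?_⟩, ?_⟩, ?_⟩, ?_⟩
  · rw [mem_preimage, zpow_apply_eq_self hf hpA]
    exact hp
  · rw [mem_preimage, zpow_apply_eq_self hf hpA]
    exact hp
  · rw [mem_preimage, zpow_apply_eq_self hg hpB]
    exact hp
  · rintro y ⟨⟨⟨hy₀, hy₁⟩, hy₂⟩, hy₃⟩
    have hk : f * ((f ^ M * g ^ m) * f * (f ^ M * g ^ m)⁻¹)⁻¹ =
        f ^ (1 + M) * (g ^ m * (f ^ (-1 : ℤ) * (g ^ (-m) * f ^ (-M)))) := by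
      group
    rw [hk]
    simp only [Equiv.Perm.mul_apply]
    by_cases hyA : y ∈ A
    · have h₁ := zpow_apply_mem hf hyA (-M)
      have h₂ := zpow_apply_mem hf hyA (-1 - M)
      rw [zpow_apply_eq_self hg (hnB _ hy₁ h₁), ← Equiv.Perm.mul_apply (f ^ (-1 : ℤ)),
        ← zpow_add, ← sub_eq_add_neg, zpow_apply_eq_self hg (hnB _ hy₂ h₂),
        ← Equiv.Perm.mul_apply, ← zpow_add]
      simp
    · have h₁ : (g ^ (-m)) y ∉ A := by
        intro h
        by_cases hyB : y ∈ B
        · exact hnB _ hy₃ h (zpow_apply_mem hg hyB _)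
        · rw [zpow_apply_eq_self hg hyB] at h
          exact hyA h
      rw [zpow_apply_eq_self hf hyA, zpow_apply_eq_self hf h₁, ← Equiv.Perm.mul_apply (g ^ m),
        ← zpow_add, add_neg_cancel, zpow_zero, Equiv.Perm.one_apply, zpow_apply_eq_self hf hyA]

theorem commutator_mul_left_eq_of_commute {G : Type*} [Group G] {u w g : G} (h : Commute w g) :
    ⁅u * w, g⁆ = ⁅u, g⁆ := by
  rw [commutatorElement_def, commutatorElement_def, mul_inv_rev, mul_assoc u w g, h.eq]
  group

theorem commutator_mul_right_eq_of_commute {G : Type*} [Group G] {u w v : G} (h : Commute u w) :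
    ⁅u, v * w⁆ = ⁅u, v⁆ := by
  rw [← inv_inj, commutatorElement_inv, commutatorElement_inv,
    commutator_mul_left_eq_of_commute h.symm]

theorem conj_apply_eq_self {f k : Equiv.Perm S1} {A : Set S1} (hf : {y | f y ≠ y} = A) {y : S1}
    (hy : k⁻¹ y ∉ A) : (k * f * k⁻¹) y = y := by
  have h := zpow_apply_eq_self hf hy 1
  rw [zpow_one] at h
  rw [Equiv.Perm.mul_apply, Equiv.Perm.mul_apply, h]
  simp

/-- The commutator of the homeomorphisms of two overlapping arcs is a commutator of two elements
that are trivial on a common nonempty open set. -/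
theorem Overlap.exists_commutator_eq {f g : Equiv.Perm S1} {A B : Set S1} {a a' b b' : S1}
    (h : Overlap f g A B a a' b b') (hA : IsOpen A) (hB : IsOpen B) (hf : {y | f y ≠ y} = A)
    (hg : {y | g y ≠ y} = B) {G : Subgroup (Equiv.Perm S1)} (hcont : ∀ x ∈ G, Continuous x)
    (hfG : f ∈ G) (hgG : g ∈ G) :
    ∃ u ∈ G, ∃ v ∈ G, ⁅f, g⁆ = ⁅u, v⁆ ∧ ∃ W : Set S1, IsOpen W ∧ W.Nonempty ∧
      (∀ y ∈ W, u y = y) ∧ ∀ y ∈ W, v y = y := by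
  have hfc : ∀ m : ℤ, Continuous (f ^ m) := fun m => hcont _ (zpow_mem hfG m)
  have hgc : ∀ m : ℤ, Continuous (g ^ m) := fun m => hcont _ (zpow_mem hgG m)
  obtain ⟨M, m, hk⟩ := h.exists_shrink hA hB hf hg isClosed_closure.isOpen_compl
    h.a'_notMem_closure
  obtain ⟨W, hW, hbW, hu⟩ := exists_isOpen_mul_conj_inv_apply hfc hgc hf hg h.b'_notMem_left
    h.b'_notMem_right h.b'_notMem_closure M m
  obtain ⟨M', m', hl⟩ := h.symm.exists_shrink hB hA hg hf hW hbW
  obtain ⟨W', hW', hbW', hv⟩ := exists_isOpen_mul_conj_inv_apply hgc hfc hg hf h.b'_notMem_right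
    h.b'_notMem_left (inter_comm A B ▸ h.b'_notMem_closure) M' m'
  set k := f ^ M * g ^ m with hkdef
  set l := g ^ M' * f ^ m' with hldef
  have hkG : k ∈ G := mul_mem (zpow_mem hfG M) (zpow_mem hgG m)
  have hlG : l ∈ G := mul_mem (zpow_mem hgG M') (zpow_mem hfG m')
  set u := f * (k * f * k⁻¹)⁻¹ with hudef
  set v := g * (l * g * l⁻¹)⁻¹ with hvdef
  have hfu : f = u * (k * f * k⁻¹) := by rw [hudef]; group
  have hgv : g = v * (l * g * l⁻¹) := by rw [hvdef]; group
  have hcomm₁ : Commute (k * f * k⁻¹) g := by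
    refine Equiv.Perm.Disjoint.commute fun y => ?_
    by_cases hyA : k⁻¹ y ∈ A
    · right
      have h₁ := hk _ hyA
      rw [← Equiv.Perm.mul_apply, mul_inv_cancel, Equiv.Perm.one_apply] at h₁
      have h₂ := zpow_apply_eq_self hg (fun hyB => h₁.1 (subset_closure ⟨h₁.2, hyB⟩)) 1
      rwa [zpow_one] at h₂
    · exact Or.inl (conj_apply_eq_self hf hyA)
  have hcomm₂ : Commute u (l * g * l⁻¹) := by
    refine Equiv.Perm.Disjoint.commute fun y => ?_
    by_cases hyB : l⁻¹ y ∈ B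
    · left
      have h₁ := hl _ hyB
      rw [← Equiv.Perm.mul_apply, mul_inv_cancel, Equiv.Perm.one_apply] at h₁
      exact hu y h₁.1
    · exact Or.inr (conj_apply_eq_self hg hyB)
  refine ⟨u, mul_mem hfG (inv_mem (mul_mem (mul_mem hkG hfG) (inv_mem hkG))), v,
    mul_mem hgG (inv_mem (mul_mem (mul_mem hlG hgG) (inv_mem hlG))), ?_,
    W ∩ W', hW.inter hW', ⟨b', hbW, hbW'⟩, fun y hy => hu y hy.1, fun y hy => hv y hy.2⟩
  calc ⁅f, g⁆ = ⁅u * (k * f * k⁻¹), g⁆ := by rw [← hfu]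
    _ = ⁅u, g⁆ := commutator_mul_left_eq_of_commute hcomm₁
    _ = ⁅u, v * (l * g * l⁻¹)⁆ := by rw [← hgv]
    _ = ⁅u, v⁆ := commutator_mul_right_eq_of_commute hcomm₂

variable {n : ℕ} {R : FastRing n}

theorem commute_of_disjoint {a b : Equiv.Perm S1} {S T : Set S1} (h : Disjoint S T)
    (ha : ∀ y ∉ S, a y = y) (hb : ∀ y ∉ T, b y = y) : Commute a b := by
  refine Equiv.Perm.Disjoint.commute fun y => ?_
  by_cases hy : y ∈ S
  · exact Or.inr (hb y (disjoint_left.1 h hy))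
  · exact Or.inl (ha y hy)

/-- If `N` is normalized by `a`, `b` and contains an element moving `U` off itself, then `N`
contains the commutator of `a` and `b` as soon as these are supported in `U`. -/
theorem commutator_mem_of_displaced {N : Subgroup (Equiv.Perm S1)} {g a b : Equiv.Perm S1}
    (hg : g ∈ N) {U : Set S1} (hU : ∀ y ∈ U, g y ∉ U) (ha : ∀ y ∉ U, a y = y)
    (hb : ∀ y ∉ U, b y = y) (haN : ∀ x ∈ N, a * x * a⁻¹ ∈ N) (hbN : ∀ x ∈ N, b * x * b⁻¹ ∈ N) :
    ⁅a, b⁆ ∈ N := by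
  have hcomm : Commute (g * a⁻¹ * g⁻¹) b := by
    refine commute_of_disjoint (S := {y | g⁻¹ y ∈ U}) (T := U) ?_ ?_ hb
    · refine disjoint_left.2 fun y hy hyU => hU _ hy ?_
      rwa [← Equiv.Perm.mul_apply, mul_inv_cancel, Equiv.Perm.one_apply]
    · intro y hy
      have h : a⁻¹ (g⁻¹ y) = g⁻¹ y := Equiv.Perm.inv_eq_iff_eq.2 (ha _ hy).symm
      rw [Equiv.Perm.mul_apply, Equiv.Perm.mul_apply, h, ← Equiv.Perm.mul_apply, mul_inv_cancel,
        Equiv.Perm.one_apply]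
  have hc : a * (g * a⁻¹ * g⁻¹) ∈ N := by
    rw [show a * (g * a⁻¹ * g⁻¹) = a * g * a⁻¹ * g⁻¹ by group]
    exact mul_mem (haN g hg) (inv_mem hg)
  rw [← commutator_mul_left_eq_of_commute hcomm, commutatorElement_def,
    mul_assoc (a * (g * a⁻¹ * g⁻¹)), mul_assoc]
  exact mul_mem hc (hbN _ (inv_mem hc))

/-- A nontrivial subgroup normalized by `Hn R` contains every commutator of two elements of `Gn R`
that are trivial on a common nonempty open set. -/
theorem commutator_mem_of_conj_mem (hn : 2 ≤ n) (hmin : MinimalAct (Gn R))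
    {N : Subgroup (Equiv.Perm S1)} (hNG : N ≤ Gn R) (hN : N ≠ ⊥)
    (hconj : ∀ h ∈ Hn R, ∀ x ∈ N, h * x * h⁻¹ ∈ N) {a b : Equiv.Perm S1} (ha : a ∈ Gn R)
    (hb : b ∈ Gn R) {W : Set S1} (hW : IsOpen W) (hWne : W.Nonempty) (haW : ∀ y ∈ W, a y = y)
    (hbW : ∀ y ∈ W, b y = y) : ⁅a, b⁆ ∈ N := by
  obtain ⟨g, hgN, hg₁⟩ := N.bot_or_exists_ne_one.resolve_left hN
  obtain ⟨p, hp⟩ : ∃ p, g p ≠ p := by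
    by_contra! hcon
    exact hg₁ (Equiv.ext hcon)
  obtain ⟨X, Y, hX, hY, hgX, hpY, hXY⟩ := t2_separation hp
  have hUo : IsOpen (Y ∩ g ⁻¹' X) := hY.inter (hX.preimage (continuous_of_mem_Gn R (hNG hgN)))
  have hU : ∀ y ∈ Y ∩ g ⁻¹' X, g y ∉ Y ∩ g ⁻¹' X := fun y hy hgy =>
    disjoint_left.1 hXY hy.2 hgy.1
  obtain ⟨U₀, U₁, hU₀, hU₁, hU₀ne, hU₁ne, hU₀U, hU₁U, h₀₁⟩ :=
    exists_disjoint_isOpen_subset hUo ⟨p, hpY, hgX⟩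
  obtain ⟨V, V', hV, hV', hVne, hV'ne, hVU, hV'U, hVV⟩ := exists_disjoint_isOpen_subset hU₁ hU₁ne
  obtain ⟨h, hhH, hhU⟩ := FastRing.contracts_Hn_of_isClosed hn hmin hW.isClosed_compl
    (compl_ne_univ.2 hWne) U₀ hU₀ hU₀ne
  have hh : h ∈ Gn R := Hn_le_Gn hhH
  have hfix : ∀ c : Equiv.Perm S1, (∀ y ∈ W, c y = y) → ∀ y ∉ U₀, (h * c * h⁻¹) y = y := by
    intro c hc y hy
    have h₁ : h⁻¹ y ∈ W := by
      by_contra hcon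
      have h₂ := hhU _ hcon
      rw [← Equiv.Perm.mul_apply, mul_inv_cancel, Equiv.Perm.one_apply] at h₂
      exact hy h₂
    rw [Equiv.Perm.mul_apply, Equiv.Perm.mul_apply, hc _ h₁, ← Equiv.Perm.mul_apply,
      mul_inv_cancel, Equiv.Perm.one_apply]
  have haU := hfix a haW
  have hbU := hfix b hbW
  obtain ⟨a₁, -, ha₁V, ha₁H⟩ := FastRing.exists_mul_mem_Hn hmin hV hVne
    (mul_mem (mul_mem hh ha) (inv_mem hh))
  obtain ⟨b₁, -, hb₁V, hb₁H⟩ := FastRing.exists_mul_mem_Hn hmin hV' hV'ne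
    (mul_mem (mul_mem hh hb) (inv_mem hh))
  have hmem := commutator_mem_of_displaced hgN hU
    (a := h * a * h⁻¹ * a₁) (b := h * b * h⁻¹ * b₁)
    (fun y hy => by
      rw [Equiv.Perm.mul_apply, ha₁V y fun hyV => hy (hU₁U (hVU hyV)),
        haU y fun hyU => hy (hU₀U hyU)])
    (fun y hy => by
      rw [Equiv.Perm.mul_apply, hb₁V y fun hyV => hy (hU₁U (hV'U hyV)),
        hbU y fun hyU => hy (hU₀U hyU)])
    (hconj _ ha₁H) (hconj _ hb₁H)
  have hca : Commute a₁ (h * b * h⁻¹ * b₁) :=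
    (commute_of_disjoint (h₀₁.symm.mono_left hVU) ha₁V hbU).mul_right
      (commute_of_disjoint hVV ha₁V hb₁V)
  have hcb : Commute (h * a * h⁻¹) b₁ := commute_of_disjoint (h₀₁.mono_right hV'U) haU hb₁V
  rw [commutator_mul_left_eq_of_commute hca, commutator_mul_right_eq_of_commute hcb] at hmem
  have h₁ := hconj _ (inv_mem hhH) _ hmem
  rwa [show h⁻¹ * ⁅h * a * h⁻¹, h * b * h⁻¹⁆ * h⁻¹⁻¹ = ⁅a, b⁆ by group] at h₁

theorem commutator_closure_le {G : Type*} [Group G] {S : Set G} {M : Subgroup G}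
    (hM : ∀ g ∈ Subgroup.closure S, ∀ x ∈ M, g * x * g⁻¹ ∈ M)
    (hS : ∀ a ∈ S, ∀ b ∈ S, ⁅a, b⁆ ∈ M) :
    ⁅Subgroup.closure S, Subgroup.closure S⁆ ≤ M := by
  refine Subgroup.commutator_le.2 fun a ha b hb => ?_
  induction ha, hb using Subgroup.closure_induction₂ with
  | mem x y hx hy => exact hS x hx y hy
  | one_left x hx => simp
  | one_right x hx => simp
  | mul_left x y z hx hy hz hxz hyz =>
    rw [show ⁅x * y, z⁆ = x * ⁅y, z⁆ * x⁻¹ * ⁅x, z⁆ by group]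
    exact mul_mem (hM x hx _ hyz) hxz
  | mul_right y z x hy hz hx hxy hxz =>
    rw [show ⁅x, y * z⁆ = ⁅x, y⁆ * (y * ⁅x, z⁆ * y⁻¹) by group]
    exact mul_mem hxy (hM y hy _ hxz)
  | inv_left x y hx hy hxy =>
    rw [show ⁅x⁻¹, y⁆ = x⁻¹ * ⁅x, y⁆⁻¹ * x⁻¹⁻¹ by group]
    exact hM _ (inv_mem hx) _ (inv_mem hxy)
  | inv_right x y hx hy hxy =>
    rw [show ⁅x, y⁻¹⁆ = y⁻¹ * ⁅x, y⁆⁻¹ * y⁻¹⁻¹ by group]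
    exact hM _ (inv_mem hy) _ (inv_mem hxy)

/-- A nontrivial subgroup of `Gn R` normalized by `Hn R` contains `Hn R`. -/
theorem Hn_le_of_conj_mem (hn : 2 ≤ n) (hmin : MinimalAct (Gn R))
    {N : Subgroup (Equiv.Perm S1)} (hNG : N ≤ Gn R) (hN : N ≠ ⊥)
    (hconj : ∀ h ∈ Hn R, ∀ x ∈ N, h * x * h⁻¹ ∈ N) : Hn R ≤ N := by
  set T : Set (Equiv.Perm S1) := {x | ∃ a ∈ Gn R, ∃ b ∈ Gn R, x = ⁅a, b⁆ ∧
    ∃ W : Set S1, IsOpen W ∧ W.Nonempty ∧ (∀ y ∈ W, a y = y) ∧ ∀ y ∈ W, b y = y} with hT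
  have hTN : Subgroup.closure T ≤ N := by
    rw [Subgroup.closure_le]
    rintro _ ⟨a, ha, b, hb, rfl, W, hW, hWne, haW, hbW⟩
    exact commutator_mem_of_conj_mem hn hmin hNG hN hconj ha hb hW hWne haW hbW
  refine le_trans (commutator_closure_le ?_ ?_) hTN
  · intro g hg x hx
    have hgc := continuous_of_mem_Gn R (inv_mem hg)
    induction hx using Subgroup.closure_induction with
    | mem x hx =>
      obtain ⟨a, ha, b, hb, rfl, W, hW, ⟨w, hw⟩, haW, hbW⟩ := hx
      have hfix : ∀ c : Equiv.Perm S1, (∀ y ∈ W, c y = y) →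
          ∀ y ∈ (g⁻¹ : Equiv.Perm S1) ⁻¹' W, (g * c * g⁻¹) y = y := by
        intro c hc y hy
        rw [Equiv.Perm.mul_apply, Equiv.Perm.mul_apply, hc _ hy, ← Equiv.Perm.mul_apply,
          mul_inv_cancel, Equiv.Perm.one_apply]
      refine Subgroup.subset_closure ⟨g * a * g⁻¹, mul_mem (mul_mem hg ha) (inv_mem hg),
        g * b * g⁻¹, mul_mem (mul_mem hg hb) (inv_mem hg), by group, _, hW.preimage hgc,
        ⟨g w, ?_⟩, hfix a haW, hfix b hbW⟩
      rwa [mem_preimage, ← Equiv.Perm.mul_apply, inv_mul_cancel, Equiv.Perm.one_apply]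
    | one => simp
    | mul x y _ _ hx hy =>
      rw [show g * (x * y) * g⁻¹ = g * x * g⁻¹ * (g * y * g⁻¹) by group]
      exact mul_mem hx hy
    | inv x _ hx =>
      rw [show g * x⁻¹ * g⁻¹ = (g * x * g⁻¹)⁻¹ by group]
      exact inv_mem hx
  · have hadj : ∀ i : ZMod n, ⁅R.f i, R.f (i + 1)⁆ ∈ Subgroup.closure T := by
      intro i
      obtain ⟨a, a', b, b', h⟩ := R.exists_overlap i
      obtain ⟨u, hu, v, hv, heq, hW⟩ := h.exists_commutator_eq (R.isOpen' _) (R.isOpen' _)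
        (R.supp _) (R.supp _) (fun _ => continuous_of_mem_Gn R) (R.mem_Gn _) (R.mem_Gn _)
      exact Subgroup.subset_closure ⟨u, hu, v, hv, heq, hW⟩
    rintro _ ⟨i, rfl⟩ _ ⟨j, rfl⟩
    by_cases hij : i = j
    · subst hij
      simp
    by_cases hji : j - i = 1
    · obtain rfl : j = i + 1 := by rw [← hji]; ring
      exact hadj i
    by_cases hij' : i - j = 1
    · obtain rfl : i = j + 1 := by rw [← hij']; ring
      rw [← commutatorElement_inv]
      exact inv_mem (hadj j)
    have hfix : ∀ i, ∀ y ∉ R.J i, R.f i y = y := fun i y hy => by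
      have := zpow_apply_eq_self (R.supp i) hy 1
      rwa [zpow_one] at this
    have hcomm : Commute (R.f i) (R.f j) := commute_of_disjoint
      (disjoint_iff_inter_eq_empty.2 (R.disj i j hij hij' hji)) (hfix i) (hfix j)
    rw [commutatorElement_eq_one_iff_commute.2 hcomm]
    exact one_mem _

theorem Hn_ne_bot (hn : 2 ≤ n) (hmin : MinimalAct (Gn R)) : Hn R ≠ ⊥ := by
  intro hbot
  obtain ⟨U₁, U₂, hU₁, hU₂, ⟨x, hx⟩, hne, -, -, hd⟩ :=
    exists_disjoint_isOpen_subset isOpen_univ (univ_nonempty (α := S1))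
  obtain ⟨h, hh, hhx⟩ := FastRing.contracts_Hn_of_isClosed hn hmin (isClosed_singleton (x := x))
    (fun he => by
      obtain ⟨y, hy⟩ := hne
      have : y ∈ ({x} : Set S1) := he ▸ mem_univ y
      rw [mem_singleton_iff] at this
      exact disjoint_left.1 hd hx (this ▸ hy)) U₂ hU₂ hne
  rw [hbot, Subgroup.mem_bot] at hh
  have h₁ := hhx x rfl
  rw [hh, Equiv.Perm.one_apply] at h₁
  exact disjoint_left.1 hd hx h₁

end Simplicity

/-- For a fast `n`-ring (`n ≥ 3`) acting minimally on `S¹`, the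
derived subgroup `H_n = [G_n, G_n]` is a simple group. -/
theorem stmt_15 (n : ℕ) (hn : 3 ≤ n) (R : FastRing n) (hmin : MinimalAct (Gn R)) :
    IsSimpleGroup ↥(Hn R) := by
  have hn' : 2 ≤ n := by omega
  have : Nontrivial ↥(Hn R) := (Subgroup.nontrivial_iff_ne_bot _).2 (Hn_ne_bot hn' hmin)
  refine ⟨fun N hN => or_iff_not_imp_left.2 fun hbot => ?_⟩
  have hle : N.map (Hn R).subtype ≤ Hn R := Subgroup.map_subtype_le N
  have key : Hn R ≤ N.map (Hn R).subtype := by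
    refine Hn_le_of_conj_mem hn' hmin (hle.trans Hn_le_Gn) ?_ ?_
    · rwa [Ne, Subgroup.map_eq_bot_iff_of_injective _ (Hn R).subtype_injective]
    · rintro h hh _ ⟨x, hx, rfl⟩
      exact ⟨⟨h, hh⟩ * x * ⟨h, hh⟩⁻¹, hN.conj_mem x hx _, rfl⟩
  refine (Subgroup.eq_top_iff' N).2 fun x => ?_
  obtain ⟨y, hy, hyx⟩ := key x.2
  rwa [← (Hn R).subtype_injective hyx]
end
end

section
/- Let f·ν_{i,j}⁻¹ ∈ ⟨X⟩ be a special element, and let g ∈ {f₁^{±1},…,f_n^{±1}} be such that Supp(f^g) is ℐ-small. Then there exists 1 ≤ k ≤ n such that (f^g)·ν_{i,k}⁻¹ is a special element of ⟨X⟩ (in particular (f^g)·ν_{i,k}⁻¹ ∈ ⟨X⟩). -/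
open Set

noncomputable section

/-- An open arc of `S¹` is *small* (w.r.t. the ring `R`) if it is contained in some
`J k`. -/
def IsSmallArc {n : ℕ} (R : FastRing n) (I : Set S1) : Prop :=
  IsOpen I ∧ IsConnected I ∧ ∃ k : ZMod n, I ⊆ R.J k

/-- A subset `S ⊆ S¹` is `ℐ`-small (w.r.t. the family `ℐ = {L i j}`) if it is contained
in a small open arc `I` such that, for all `i j`: if `I` meets `L i j` then `I` misses
`J j`, and if `I` meets `J j` then `I` misses `L i j`. -/
def ISmallSet {n : ℕ} (R : FastRing n) (L : ZMod n → ZMod n → Set S1) (S : Set S1) :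
    Prop :=
  ∃ I : Set S1, IsSmallArc R I ∧
    (∀ i j : ZMod n, (I ∩ L i j).Nonempty → I ∩ R.J j = ∅) ∧
    (∀ i j : ZMod n, (I ∩ R.J j).Nonempty → I ∩ L i j = ∅) ∧
    S ⊆ I

/-- `ν_{i,j} = λ_{i,j}⁻¹ f_i λ_{i,j}` (in the right-action convention; as a
left-composition permutation this is `λ_{i,j} ∘ f_i ∘ λ_{i,j}⁻¹`). -/
def nuEl {n : ℕ} (R : FastRing n) (lam : ZMod n → ZMod n → Equiv.Perm S1)
    (i j : ZMod n) : Equiv.Perm S1 :=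
  lam i j * R.f i * (lam i j)⁻¹

/-- The finite generating set `X = {ν_{i,j}⁻¹ f_i : 1 ≤ i, j ≤ n}` (right-action words;
`ν_{i,j}⁻¹ f_i` applies `ν_{i,j}⁻¹` first, i.e. it is the permutation
`f_i ∘ ν_{i,j}⁻¹`). -/
def Xset {n : ℕ} (R : FastRing n) (lam : ZMod n → ZMod n → Equiv.Perm S1) :
    Set (Equiv.Perm S1) :=
  {p : Equiv.Perm S1 | ∃ i j : ZMod n, p = R.f i * (nuEl R lam i j)⁻¹}

/-- The element `f · ν_{i,j}⁻¹` is a *special element* of `⟨X⟩` if it lies in `⟨X⟩`,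
the supports of `f` and `ν_{i,j}` are disjoint, and the support of `f` is `ℐ`-small. -/
def SpecialEl {n : ℕ} (R : FastRing n) (L : ZMod n → ZMod n → Set S1)
    (lam : ZMod n → ZMod n → Equiv.Perm S1) (f : Equiv.Perm S1) (i j : ZMod n) : Prop :=
  (nuEl R lam i j)⁻¹ * f ∈ Subgroup.closure (Xset R lam) ∧
  {p : S1 | f p ≠ p} ∩ {p : S1 | nuEl R lam i j p ≠ p} = ∅ ∧
  ISmallSet R L {p : S1 | f p ≠ p}

/-- Permutations whose supports lie in disjoint sets commute. -/
theorem commute_of_support_subset {α : Type*} {a b : Equiv.Perm α} {A B : Set α}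
    (ha : {p | a p ≠ p} ⊆ A) (hb : {p | b p ≠ p} ⊆ B) (hAB : A ∩ B = ∅) : Commute a b := by
  refine Equiv.Perm.Disjoint.commute fun p => ?_
  by_contra! h
  exact (hAB.subset ⟨ha h.1, hb h.2⟩ : p ∈ (∅ : Set α))

theorem support_nuEl_subset {n : ℕ} (R : FastRing n) {L : ZMod n → ZMod n → Set S1}
    {lam : ZMod n → ZMod n → Equiv.Perm S1} {i j : ZMod n}
    (h : (fun p : S1 => lam i j p) '' R.J i ⊆ L i j) :
    {p : S1 | nuEl R lam i j p ≠ p} ⊆ L i j := by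
  intro p hp
  refine h ⟨(lam i j)⁻¹ p, ?_, by simp⟩
  rw [← R.supp i]
  intro hfix
  exact hp (by rw [nuEl, Equiv.Perm.mul_apply, Equiv.Perm.mul_apply, hfix]; simp)

/-- An `ℐ`-small set misses all the arcs `L i m`, for a suitable `m`. -/
theorem ISmallSet.exists_inter_eq_empty {n : ℕ} {R : FastRing n}
    {L : ZMod n → ZMod n → Set S1} {S : Set S1} (h : ISmallSet R L S) :
    ∃ m, ∀ i, S ∩ L i m = ∅ := by
  obtain ⟨I, ⟨-, ⟨⟨p, hp⟩, -⟩, m, hm⟩, -, hmeet, hSI⟩ := h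
  exact ⟨m, fun i => subset_empty_iff.1
    ((inter_subset_inter_left _ hSI).trans (hmeet i m ⟨p, hp, hm hp⟩).subset)⟩

/-- If `a ν_{i,j}⁻¹` lies in `⟨X⟩`, then so does `a ν_{i,k}⁻¹`. -/
theorem inv_nuEl_mul_mem_of_mem {n : ℕ} {R : FastRing n}
    {lam : ZMod n → ZMod n → Equiv.Perm S1} {i j k : ZMod n} {a : Equiv.Perm S1}
    (hcomm : Commute (nuEl R lam i j) (nuEl R lam i k))
    (h : (nuEl R lam i j)⁻¹ * a ∈ Subgroup.closure (Xset R lam)) :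
    (nuEl R lam i k)⁻¹ * a ∈ Subgroup.closure (Xset R lam) := by
  have hX (l : ZMod n) : R.f i * (nuEl R lam i l)⁻¹ ∈ Subgroup.closure (Xset R lam) :=
    Subgroup.subset_closure ⟨i, l, rfl⟩
  have hmem := mul_mem (mul_mem (inv_mem (hX j)) (hX k)) h
  have hinv : nuEl R lam i j * (nuEl R lam i k)⁻¹ =
      (nuEl R lam i k)⁻¹ * nuEl R lam i j := hcomm.inv_right.eq
  convert hmem using 1
  calc (nuEl R lam i k)⁻¹ * a
      = ((nuEl R lam i k)⁻¹ * nuEl R lam i j) * ((nuEl R lam i j)⁻¹ * a) := by group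
    _ = (nuEl R lam i j * (nuEl R lam i k)⁻¹) * ((nuEl R lam i j)⁻¹ * a) := by rw [hinv]
    _ = _ := by group

/-- Lemma 3.7 of the paper. If `f·ν_{i,j}⁻¹ ∈ ⟨X⟩` is a special
element and `g ∈ {f₁^{±1}, …, f_n^{±1}}` is such that `Supp(f^g)` is `ℐ`-small, then
`(f^g)·ν_{i,k}⁻¹` is a special element of `⟨X⟩` for some `k`.
(In the right-action convention `f^g = g⁻¹fg` is the permutation `g ∘ f ∘ g⁻¹`,
i.e. `g * f * g⁻¹`.) -/
theorem stmt_16 (n : ℕ) (hn : 3 ≤ n) (R : FastRing n) (hmin : MinimalAct (Gn R))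
    (L : ZMod n → ZMod n → Set S1)
    (hLarc : ∀ i j, IsSmallArc R (L i j))
    (hLdisj : ∀ i j i' j' : ZMod n, (i, j) ≠ (i', j') → L i j ∩ L i' j' = ∅)
    (hLint : ∀ i j, L i j ⊆ interior ((R.J j)ᶜ))
    (lam : ZMod n → ZMod n → Equiv.Perm S1)
    (hlam : ∀ i j, lam i j ∈ Gn R)
    (hlamI : ∀ i j, (fun p : S1 => lam i j p) '' R.J i ⊆ L i j)
    (f : Equiv.Perm S1) (hfOP : CircleOP f) (i j : ZMod n)
    (hspecial : SpecialEl R L lam f i j)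
    (g : Equiv.Perm S1) (hg : ∃ k : ZMod n, g = R.f k ∨ g = (R.f k)⁻¹)
    (hsmall : ISmallSet R L {p : S1 | (g * f * g⁻¹) p ≠ p}) :
    ∃ k : ZMod n, SpecialEl R L lam (g * f * g⁻¹) i k := by
  have hν (a b : ZMod n) := support_nuEl_subset R (hlamI a b)
  have hνν (a b c d : ZMod n) : Commute (nuEl R lam a b) (nuEl R lam c d) := by
    by_cases h : (a, b) = (c, d)
    · obtain ⟨rfl, rfl⟩ := Prod.mk.inj h
      exact Commute.refl _
    · exact commute_of_support_subset (hν a b) (hν c d) (hLdisj a b c d h)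
  have hfν (a b : ZMod n) : Commute (R.f b) (nuEl R lam a b) :=
    commute_of_support_subset (R.supp b).subset (hν a b)
      (disjoint_compl_right.mono_right ((hLint a b).trans interior_subset)).inter_eq
  obtain ⟨hmem, -, hfsmall⟩ := hspecial
  obtain ⟨m, hm⟩ := hfsmall.exists_inter_eq_empty
  obtain ⟨m', hm'⟩ := hsmall.exists_inter_eq_empty
  obtain ⟨k, hk⟩ := hg
  obtain ⟨y, hy, hyf, hyν⟩ : ∃ y ∈ Subgroup.closure (Xset R lam),
      y * f * y⁻¹ = g * f * g⁻¹ ∧ Commute y (nuEl R lam i k) := by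
    have hX (l : ZMod n) : R.f k * (nuEl R lam k l)⁻¹ ∈ Subgroup.closure (Xset R lam) :=
      Subgroup.subset_closure ⟨k, l, rfl⟩
    have hXν (l : ZMod n) : Commute (R.f k * (nuEl R lam k l)⁻¹) (nuEl R lam i k) :=
      (hfν i k).mul_left (hνν k l i k).inv_left
    rcases hk with rfl | rfl
    · refine ⟨_, hX m, ?_, hXν m⟩
      have hc : Commute f (nuEl R lam k m) :=
        commute_of_support_subset Subset.rfl (hν k m) (hm k)
      calc R.f k * (nuEl R lam k m)⁻¹ * f * (R.f k * (nuEl R lam k m)⁻¹)⁻¹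
          = R.f k * ((nuEl R lam k m)⁻¹ * f * nuEl R lam k m) * (R.f k)⁻¹ := by group
        _ = R.f k * f * (R.f k)⁻¹ := by rw [hc.symm.inv_mul_cancel]
    · refine ⟨_, inv_mem (hX m'), ?_, (hXν m').inv_left⟩
      have hc : Commute ((R.f k)⁻¹ * f * (R.f k)⁻¹⁻¹) (nuEl R lam k m') :=
        commute_of_support_subset Subset.rfl (hν k m') (hm' k)
      calc (R.f k * (nuEl R lam k m')⁻¹)⁻¹ * f * (R.f k * (nuEl R lam k m')⁻¹)⁻¹⁻¹
          = nuEl R lam k m' * ((R.f k)⁻¹ * f * (R.f k)⁻¹⁻¹) * (nuEl R lam k m')⁻¹ := by group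
        _ = (R.f k)⁻¹ * f * (R.f k)⁻¹⁻¹ := hc.symm.mul_inv_cancel
  have hconj : (nuEl R lam i k)⁻¹ * (g * f * g⁻¹) ∈ Subgroup.closure (Xset R lam) := by
    have hmem' := mul_mem (mul_mem hy (inv_nuEl_mul_mem_of_mem (hνν i j i k) hmem)) (inv_mem hy)
    rwa [← mul_assoc y, hyν.inv_right.eq, mul_assoc _ y f, mul_assoc, hyf] at hmem'
  refine ⟨m', inv_nuEl_mul_mem_of_mem (hνν i k i m') hconj, ?_, hsmall⟩
  exact subset_empty_iff.1 ((inter_subset_inter_right _ (hν i m')).trans (hm' i).subset)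
end
end

section
/- H_n = ⟨X⟩: the derived subgroup H_n of G_n is generated by the n² elements ν_{i,j}⁻¹f_i (1 ≤ i, j ≤ n). In particular, H_n is finitely generated. -/
open Set

noncomputable section

/-- Permutations whose supports lie in disjoint sets commute. -/
theorem commute_of_supports_subset {α : Type*} {f g : Equiv.Perm α} {A B : Set α}
    (hf : {p | f p ≠ p} ⊆ A) (hg : {p | g p ≠ p} ⊆ B) (hAB : A ∩ B = ∅) : Commute f g := by
  refine Equiv.Perm.Disjoint.commute fun p => ?_
  by_contra! h
  exact (hAB ▸ ⟨hf h.1, hg h.2⟩ : p ∈ (∅ : Set α))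

/-- The support of a conjugate lies in any set containing the image of the support. -/
theorem support_conj_subset {α : Type*} {f g : Equiv.Perm α} {A B : Set α}
    (hf : {p | f p ≠ p} ⊆ A) (hg : (fun p => g p) '' A ⊆ B) :
    {p | (g * f * g⁻¹) p ≠ p} ⊆ B := by
  intro p hp
  refine hg ⟨g⁻¹ p, hf fun h => hp ?_, by simp⟩
  rw [Equiv.Perm.mul_apply, Equiv.Perm.mul_apply, h]
  exact g.apply_symm_apply p

section Group

open scoped commutatorElement

variable {P ι : Type*} [Group P]

/-- If the generators of a subgroup commute modulo a subgroup they normalize, then that subgroup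
contains the derived subgroup. -/
theorem commutator_closure_le_s18 {S : Set P} {K : Subgroup P}
    (hnorm : Subgroup.closure S ≤ Subgroup.normalizer (K : Set P))
    (hcomm : ∀ a ∈ S, ∀ b ∈ S, ⁅a, b⁆ ∈ K) :
    ⁅Subgroup.closure S, Subgroup.closure S⁆ ≤ K := by
  have conj_mem : ∀ g ∈ Subgroup.closure S, ∀ k ∈ K, g * k * g⁻¹ ∈ K := fun g hg k hk =>
    (Subgroup.mem_normalizer_iff.1 (hnorm hg) k).1 hk
  have extend : ∀ c, (∀ a ∈ S, ⁅a, c⁆ ∈ K) → ∀ g ∈ Subgroup.closure S, ⁅g, c⁆ ∈ K := by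
    intro c hc g hg
    induction hg using Subgroup.closure_induction with
    | mem a ha => exact hc a ha
    | one => simp
    | mul a b ha hb iha ihb =>
      have : ⁅a * b, c⁆ = a * ⁅b, c⁆ * a⁻¹ * ⁅a, c⁆ := by simp only [commutatorElement_def]; group
      exact this ▸ K.mul_mem (conj_mem a ha _ ihb) iha
    | inv a ha iha =>
      have : ⁅a⁻¹, c⁆ = a⁻¹ * ⁅a, c⁆⁻¹ * a⁻¹⁻¹ := by simp only [commutatorElement_def]; group
      exact this ▸ conj_mem _ (inv_mem ha) _ (K.inv_mem iha)
  refine Subgroup.commutator_le.2 fun a ha b hb => extend b (fun s hs => ?_) a ha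
  rw [← commutatorElement_inv]
  exact K.inv_mem (extend s (fun t ht => hcomm t ht s hs) b hb)

variable {f : ι → P} {ν : ι → ι → P}

/-- The subgroup generated by the `f i * (ν i j)⁻¹` is normalized by the `f k`, provided the `ν i j`
commute with each other and with `f j`. -/
theorem closure_range_le_normalizer (hf : ∀ i j, Commute (ν i j) (f j))
    (hν : ∀ i j k l, Commute (ν i j) (ν k l)) :
    Subgroup.closure (Set.range f) ≤ Subgroup.normalizer
      (Subgroup.closure {p | ∃ i j, p = f i * (ν i j)⁻¹} : Set P) := by
  set X : Set P := {p | ∃ i j, p = f i * (ν i j)⁻¹}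
  set K := Subgroup.closure X
  have mem : ∀ i j, f i * (ν i j)⁻¹ ∈ K := fun i j => Subgroup.subset_closure ⟨i, j, rfl⟩
  have comm : ∀ k i j, Commute (ν k i) (f i * (ν i j)⁻¹) := fun k i j =>
    (hf k i).mul_right (hν k i i j).inv_right
  have conj_mem : ∀ k i j, f k * (f i * (ν i j)⁻¹) * (f k)⁻¹ ∈ K := by
    intro k i j
    have : f k * (f i * (ν i j)⁻¹) * (f k)⁻¹ =
        (f k * (ν k i)⁻¹) * (f i * (ν i j)⁻¹) * (f k * (ν k i)⁻¹)⁻¹ := by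
      have h := (comm k i j).eq
      generalize f i * (ν i j)⁻¹ = x at h ⊢
      simp only [mul_inv_rev, inv_inv, mul_assoc]
      rw [← mul_assoc x, ← h]
      group
    exact this ▸ K.mul_mem (K.mul_mem (mem k i) (mem i j)) (K.inv_mem (mem k i))
  have inv_conj_mem_of : ∀ z k i j, z ∈ K → f k = ν k i * z →
      (f k)⁻¹ * (f i * (ν i j)⁻¹) * f k ∈ K := by
    intro z k i j hz hk
    have : (f k)⁻¹ * (f i * (ν i j)⁻¹) * f k = z⁻¹ * (f i * (ν i j)⁻¹) * z := by
      have h := (comm k i j).eq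
      rw [hk]
      generalize f i * (ν i j)⁻¹ = x at h ⊢
      simp only [mul_inv_rev, mul_assoc]
      rw [← mul_assoc x, ← h]
      group
    exact this ▸ K.mul_mem (K.mul_mem (K.inv_mem hz) (mem i j)) hz
  have rev_mem : ∀ k i, (ν k i)⁻¹ * f k ∈ K := by
    intro k i
    have h := inv_conj_mem_of (f k * (ν k k)⁻¹) k k i (mem k k)
      (by rw [← mul_assoc, (hf k k).eq]; group)
    simpa [mul_assoc] using h
  have inv_conj_mem : ∀ k i j, (f k)⁻¹ * (f i * (ν i j)⁻¹) * f k ∈ K := fun k i j =>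
    inv_conj_mem_of _ k i j (rev_mem k i) (by group)
  rw [Subgroup.closure_le]
  rintro _ ⟨k, rfl⟩
  refine Subgroup.mem_normalizer_iff.2 fun g => ⟨fun hg => ?_, fun hg => ?_⟩
  · have hle : K ≤ K.comap (MulAut.conj (f k)).toMonoidHom := by
      rw [Subgroup.closure_le]
      rintro _ ⟨i, j, rfl⟩
      simpa using conj_mem k i j
    simpa using hle hg
  · have hle : K ≤ K.comap (MulAut.conj (f k)⁻¹).toMonoidHom := by
      rw [Subgroup.closure_le]
      rintro _ ⟨i, j, rfl⟩
      simpa using inv_conj_mem k i j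
    simpa [mul_assoc] using hle hg

/-- If each `ν i j` is a conjugate of `f i` in `⟨f⟩` commuting with `f j`, and the `ν i j` commute
with each other, then the elements `f i * (ν i j)⁻¹` generate the derived subgroup of `⟨f⟩`. -/
theorem closure_eq_commutator_of_commute {lam : ι → ι → P}
    (hlam : ∀ i j, lam i j ∈ Subgroup.closure (Set.range f))
    (hν' : ∀ i j, ν i j = lam i j * f i * (lam i j)⁻¹)
    (hf : ∀ i j, Commute (ν i j) (f j)) (hν : ∀ i j k l, Commute (ν i j) (ν k l)) :
    Subgroup.closure {p | ∃ i j, p = f i * (ν i j)⁻¹} =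
      ⁅Subgroup.closure (Set.range f), Subgroup.closure (Set.range f)⁆ := by
  have hnorm := closure_range_le_normalizer hf hν
  apply le_antisymm
  · rw [Subgroup.closure_le]
    rintro _ ⟨i, j, rfl⟩
    have : f i * (ν i j)⁻¹ = ⁅f i, lam i j⁆ := by
      rw [hν', commutatorElement_def]; group
    exact this ▸ Subgroup.commutator_mem_commutator
      (Subgroup.subset_closure (Set.mem_range_self i)) (hlam i j)
  · refine commutator_closure_le_s18 hnorm ?_
    rintro _ ⟨i, rfl⟩ _ ⟨j, rfl⟩
    have mem : f i * (ν i j)⁻¹ ∈ Subgroup.closure {p | ∃ i j, p = f i * (ν i j)⁻¹} :=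
      Subgroup.subset_closure ⟨i, j, rfl⟩
    have conj_mem := (Subgroup.mem_normalizer_iff.1
      (hnorm (Subgroup.subset_closure (Set.mem_range_self j))) _).1 (inv_mem mem)
    have : ⁅f i, f j⁆ = f i * (ν i j)⁻¹ * (f j * (f i * (ν i j)⁻¹)⁻¹ * (f j)⁻¹) := by
      simp only [commutatorElement_def, mul_inv_rev, inv_inv, mul_assoc]
      rw [← mul_assoc (f j) (ν i j), ← (hf i j).eq]
      group
    exact this ▸ mul_mem mem conj_mem

end Group

/-- Theorem 3.9 of the paper. `H_n = ⟨X⟩`: the derived subgroup of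
`G_n` is generated by the `n²` elements `ν_{i,j}⁻¹ f_i`; in particular, `H_n` is
finitely generated. -/
theorem stmt_18 (n : ℕ) (hn : 3 ≤ n) (R : FastRing n) (hmin : MinimalAct (Gn R))
    (L : ZMod n → ZMod n → Set S1)
    (hLarc : ∀ i j, IsSmallArc R (L i j))
    (hLdisj : ∀ i j i' j' : ZMod n, (i, j) ≠ (i', j') → L i j ∩ L i' j' = ∅)
    (hLint : ∀ i j, L i j ⊆ interior ((R.J j)ᶜ))
    (lam : ZMod n → ZMod n → Equiv.Perm S1)
    (hlam : ∀ i j, lam i j ∈ Gn R)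
    (hlamI : ∀ i j, (fun p : S1 => lam i j p) '' R.J i ⊆ L i j) :
    Subgroup.closure (Xset R lam) = Hn R ∧ (Hn R).FG := by
  have hsupp : ∀ i j, {p | nuEl R lam i j p ≠ p} ⊆ L i j := fun i j =>
    support_conj_subset (R.supp i).subset (hlamI i j)
  have hLJ : ∀ i j, L i j ∩ R.J j = ∅ := fun i j =>
    Set.disjoint_iff_inter_eq_empty.1
      (Set.disjoint_left.2 fun _ hp => interior_subset (hLint i j hp))
  have hH : Subgroup.closure (Xset R lam) = Hn R := by
    refine closure_eq_commutator_of_commute hlam (fun _ _ => rfl)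
      (fun i j => commute_of_supports_subset (hsupp i j) (R.supp j).subset (hLJ i j))
      fun i j k l => ?_
    by_cases h : (i, j) = (k, l)
    · obtain ⟨rfl, rfl⟩ := Prod.mk.inj h
      exact Commute.refl _
    · exact commute_of_supports_subset (hsupp i j) (hsupp k l) (hLdisj i j k l h)
  refine ⟨hH, (Subgroup.fg_iff _).2 ⟨Xset R lam, hH, ?_⟩⟩
  have : NeZero n := ⟨by omega⟩
  refine (Set.finite_range fun q : ZMod n × ZMod n =>
    R.f q.1 * (nuEl R lam q.1 q.2)⁻¹).subset ?_
  rintro _ ⟨i, j, rfl⟩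
  exact ⟨(i, j), rfl⟩
end
end
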